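/- Assume the limits ω₋ and ω₊ of q at −∞ and +∞ exist in the extended reals, that there exists D > 0 such that q(u) < ω₋ for all u ≤ −D and q(u) < ω₊ for all u ≥ D, and that min{ω₋,ω₊} < +∞. Then there exists s₀ ∈ (−∞, ā·ω₋) such that: for s < s₀, equation (WE_s) has no T-periodic solutions; for s = s₀, it has at least one T-periodic solution; for s₀ < s < ā·ω₋, it has at least one T-periodic solution; and for s₀ < s < ā·min{ω₋,ω₊}, it has at least two T-periodic solutions. -/

import Mathlib

open MeasureTheory Set Filter

noncomputable section

/-- The Lebesgue measure restricted to the interval `[0,T]`. -/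
def muT (T : ℝ) : Measure ℝ := volume.restrict (Icc 0 T)

/-- `u` is a `C¹` function on `[0,T]` with derivative `u'` there, satisfying the
`T`-periodic boundary conditions `u 0 = u T` and `u' 0 = u' T`. -/
def IsC1Periodic (T : ℝ) (u u' : ℝ → ℝ) : Prop :=
  (∀ t ∈ Icc (0:ℝ) T, HasDerivWithinAt u (u' t) (Icc (0:ℝ) T) t) ∧
    ContinuousOn u' (Icc (0:ℝ) T) ∧ u 0 = u T ∧ u' 0 = u' T

/-- `φ ∘ u'` is absolutely continuous on `[0,T]`, being the indefinite integral of the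
integrable function `w` (which is then its a.e. derivative). -/
def IsACPhiDeriv (T : ℝ) (φ : ℝ → ℝ) (u' w : ℝ → ℝ) : Prop :=
  IntegrableOn w (Icc (0:ℝ) T) ∧
    ∀ t ∈ Icc (0:ℝ) T, φ (u' t) = φ (u' 0) + ∫ τ in (0:ℝ)..t, w τ

/-- `u` is a `T`-periodic solution of `(φ(u'))' + f(u)u' + a(t) q(u) = s + e(t)`. -/
def IsSolWE (T : ℝ) (φ f q a e : ℝ → ℝ) (s : ℝ) (u : ℝ → ℝ) : Prop :=
  ∃ u' w : ℝ → ℝ, IsC1Periodic T u u' ∧ IsACPhiDeriv T φ u' w ∧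
    ∀ᵐ t ∂(muT T), w t + f (u t) * u' t + a t * q (u t) = s + e t

open Metric Topology

theorem exists_extrapolation_weights (d : ℕ) {t₀ : ℝ} (ht₀ : 0 < t₀) :
    ∃ c v : Fin (d + 1) → ℝ, (∀ i, v i ∈ Ioo 0 t₀) ∧ ∑ i, c i = 1 ∧
      ∀ p : Polynomial ℝ, p.natDegree ≤ d → p.eval 1 = ∑ i, c i * p.eval (v i) := by
  let v : Fin (d + 1) → ℝ := fun i => t₀ * ((i : ℝ) + 1) / (d + 2)
  have hv : Set.InjOn v (Finset.univ : Finset (Fin (d + 1))) := by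
    intro i _ j _ h
    have hd : (0 : ℝ) < d + 2 := by positivity
    simp only [v] at h
    field_simp at h
    ext
    exact_mod_cast add_right_cancel h
  refine ⟨fun i => (Lagrange.basis Finset.univ v i).eval 1, v, fun i => ?_, ?_, fun p hp => ?_⟩
  · have hi : (i : ℝ) + 1 ≤ d + 1 := by
      have := i.2
      exact_mod_cast this
    have hd : (0 : ℝ) < d + 2 := by positivity
    constructor
    · simp only [v]; positivity
    · simp only [v]
      rw [div_lt_iff₀ hd]
      exact mul_lt_mul_of_pos_left (by linarith) ht₀
  · rw [← Polynomial.eval_finsetSum, Lagrange.sum_basis hv Finset.univ_nonempty]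
    simp
  · have hdeg : p.degree < (Finset.univ : Finset (Fin (d + 1))).card := by
      rw [Finset.card_univ, Fintype.card_fin]
      refine lt_of_le_of_lt Polynomial.degree_le_natDegree ?_
      exact_mod_cast Nat.lt_succ_of_le hp
    conv_lhs => rw [Lagrange.eq_interpolate hv hdeg]
    rw [Lagrange.interpolate_apply, Polynomial.eval_finsetSum]
    refine Finset.sum_congr rfl fun i _ => ?_
    rw [Polynomial.eval_mul, Polynomial.eval_C, mul_comm]

theorem exists_polynomial_det_id_add_smul {E : Type*} [NormedAddCommGroup E] [NormedSpace ℝ E]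
    [FiniteDimensional ℝ E]
    (A : E →L[ℝ] E) :
    ∃ p : Polynomial ℝ, p.natDegree ≤ Module.finrank ℝ E ∧
      ∀ t : ℝ, p.eval t = (ContinuousLinearMap.id ℝ E + t • A).det := by
  let b := Module.finBasis ℝ E
  let M := LinearMap.toMatrix b b (A : E →ₗ[ℝ] E)
  refine ⟨Matrix.det ((Polynomial.X : Polynomial ℝ) • M.map Polynomial.C +
    (1 : Matrix _ _ ℝ).map Polynomial.C), ?_, fun t => ?_⟩
  · simpa using Polynomial.natDegree_det_X_add_C_le M 1
  · have h1 : (ContinuousLinearMap.id ℝ E + t • A).det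
        = LinearMap.det (LinearMap.id + t • (A : E →ₗ[ℝ] E)) := rfl
    rw [h1, ← LinearMap.det_toMatrix b, ← Polynomial.coe_evalRingHom, RingHom.map_det]
    congr 1
    ext i j
    by_cases hij : i = j <;> simp [M, hij] <;> ring

theorem lipschitzWith_indicator_closedBall {E : Type*} [NormedAddCommGroup E] [NormedSpace ℝ E]
    {G : E → E} {L : NNReal}
    (hL : LipschitzOnWith L G (closedBall 0 1)) (h0 : ∀ x, ‖x‖ = 1 → G x = 0) :
    LipschitzWith L ((closedBall (0 : E) 1).indicator G) := by
  have key : ∀ x y : E, ‖x‖ ≤ 1 → 1 < ‖y‖ → dist (G x) 0 ≤ L * dist x y := by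
    intro x y hx hy
    have hc : ContinuousOn (fun s : ℝ => ‖AffineMap.lineMap x y s‖) (Icc 0 1) := by
      apply Continuous.continuousOn
      exact (AffineMap.lineMap_continuous).norm
    obtain ⟨s, hs, hs1⟩ := intermediate_value_Icc zero_le_one hc
      (show (1 : ℝ) ∈ Icc _ _ by simpa using ⟨hx, hy.le⟩)
    simp only at hs1
    set z := AffineMap.lineMap x y s
    have hz : dist x z ≤ dist x y := by
      have : dist x z = ‖s‖ * dist x y := by simp [z]
      rw [this, Real.norm_of_nonneg hs.1]
      exact mul_le_of_le_one_left dist_nonneg hs.2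
    calc dist (G x) 0 = dist (G x) (G z) := by rw [h0 z hs1]
      _ ≤ L * dist x z := hL.dist_le_mul x (by simpa using hx) z (by simp [hs1])
      _ ≤ L * dist x y := by gcongr
  refine LipschitzWith.of_dist_le_mul fun x y => ?_
  by_cases hx : ‖x‖ ≤ 1 <;> by_cases hy : ‖y‖ ≤ 1
  · rw [indicator_of_mem (by simpa using hx), indicator_of_mem (by simpa using hy)]
    exact hL.dist_le_mul x (by simpa using hx) y (by simpa using hy)
  · rw [indicator_of_mem (by simpa using hx), indicator_of_notMem (by simpa using hy)]
    exact key x y hx (not_le.1 hy)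
  · rw [indicator_of_notMem (by simpa using hx), indicator_of_mem (by simpa using hy),
      dist_comm, dist_comm x y]
    exact key y x hy (not_le.1 hx)
  · rw [indicator_of_notMem (by simpa using hx), indicator_of_notMem (by simpa using hy), dist_self]
    positivity

theorem surjective_id_add_of_lipschitz {E : Type*} [NormedAddCommGroup E] [CompleteSpace E]
    {G : E → E} {L : NNReal} (hL : L < 1)
    (hG : LipschitzWith L G) : Function.Surjective fun x => x + G x := by
  intro y
  have hc : ContractingWith L fun x => y - G x := by
    refine ⟨hL, LipschitzWith.of_dist_le_mul fun a b => ?_⟩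
    rw [dist_sub_left]
    exact hG.dist_le_mul a b
  refine ⟨hc.fixedPoint, ?_⟩
  have : y - G hc.fixedPoint = hc.fixedPoint := hc.fixedPoint_isFixedPt
  simp only
  nth_rewrite 1 [← this]
  abel

theorem det_id_add_pos {E : Type*} [NormedAddCommGroup E] [NormedSpace ℝ E]
    [FiniteDimensional ℝ E] {A : E →L[ℝ] E} (hA : ‖A‖ < 1) :
    0 < (ContinuousLinearMap.id ℝ E + A).det := by
  have hne : ∀ s ∈ Icc (0 : ℝ) 1, (ContinuousLinearMap.id ℝ E + s • A).det ≠ 0 := by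
    intro s hs h
    have h' : LinearMap.det ((ContinuousLinearMap.id ℝ E + s • A : E →L[ℝ] E) : E →ₗ[ℝ] E) = 0 := h
    obtain ⟨v, hv, hv0⟩ := (Submodule.ne_bot_iff _).1 (LinearMap.bot_lt_ker_of_det_eq_zero h').ne'
    have hv1 : v + s • A v = 0 := by simpa using hv
    have h2 : ‖v‖ = s * ‖A v‖ := by
      rw [eq_neg_of_add_eq_zero_left hv1, norm_neg, norm_smul, Real.norm_of_nonneg hs.1]
      rw [← eq_neg_of_add_eq_zero_left hv1]
    have h3 : ‖A v‖ ≤ ‖A‖ * ‖v‖ := A.le_opNorm v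
    have h4 : 0 < ‖v‖ := norm_pos_iff.2 hv0
    have h5 : s * ‖A v‖ ≤ ‖A v‖ := mul_le_of_le_one_left (norm_nonneg _) hs.2
    nlinarith
  have hc : ContinuousOn (fun s : ℝ => (ContinuousLinearMap.id ℝ E + s • A).det) (Icc 0 1) :=
    (ContinuousLinearMap.continuous_det.comp (by fun_prop)).continuousOn
  by_contra hneg
  obtain ⟨s, hs, hs0⟩ := intermediate_value_Icc' zero_le_one hc
    (show (0 : ℝ) ∈ Icc _ _ by
      constructor
      · simpa using hneg
      · simp [ContinuousLinearMap.det])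
  exact hne s hs hs0

/-- The closed unit ball of a Euclidean space does not retract onto its boundary by a `C¹` map. -/
theorem no_contDiff_retraction_sphere {E : Type*} [NormedAddCommGroup E] [InnerProductSpace ℝ E]
    [FiniteDimensional ℝ E] {r : E → E}
    (hr : ∀ x ∈ closedBall (0 : E) 1, ContDiffAt ℝ 1 r x)
    (hsphere : ∀ x ∈ closedBall (0 : E) 1, ‖r x‖ = 1) (hid : ∀ x, ‖x‖ = 1 → r x = x) : False := by
  have : CompleteSpace E := FiniteDimensional.complete ℝ E
  borelize E
  let μ : Measure E := volume
  set G : E → E := fun x => r x - x with hG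
  have hGc : ∀ x ∈ closedBall (0 : E) 1, ContDiffAt ℝ 1 G x := fun x hx =>
    (hr x hx).sub contDiffAt_id
  obtain ⟨L, hL⟩ : ∃ L, LipschitzOnWith L G (closedBall (0 : E) 1) := by
    apply LocallyLipschitzOn.exists_lipschitzOnWith_of_compact (isCompact_closedBall 0 1)
    intro x hx
    obtain ⟨K, t, ht, hK⟩ := (hGc x hx).exists_lipschitzOnWith
    exact ⟨K, t, mem_nhdsWithin_of_mem_nhds ht, hK⟩
  have hG0 : ∀ x, ‖x‖ = 1 → G x = 0 := fun x hx => by simp [hG, hid x hx]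
  have hder : ∀ x ∈ ball (0 : E) 1, HasFDerivAt G (fderiv ℝ G x) x := fun x hx =>
    ((hGc x (ball_subset_closedBall hx)).differentiableAt (by simp)).hasFDerivAt
  have hnorm : ∀ x ∈ ball (0 : E) 1, ‖fderiv ℝ G x‖ ≤ L := fun x hx =>
    (hder x hx).le_of_lipschitzOn
      (mem_of_superset (isOpen_ball.mem_nhds hx) ball_subset_closedBall) hL
  have hdet1 : ∀ x ∈ ball (0 : E) 1,
      (ContinuousLinearMap.id ℝ E + (1 : ℝ) • fderiv ℝ G x).det = 0 := by
    intro x hx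
    by_contra hne
    have hrd : HasFDerivAt r (ContinuousLinearMap.id ℝ E + fderiv ℝ G x) x := by
      have := (hasFDerivAt_id x).add (hder x hx)
      refine this.congr_of_eventuallyEq (Eventually.of_forall fun y => ?_)
      simp [hG]
    rw [one_smul] at hne
    have hsq : HasFDerivAt (fun y => ‖r y‖ ^ 2)
        (2 • (innerSL ℝ (r x)).comp (ContinuousLinearMap.id ℝ E + fderiv ℝ G x)) x := hrd.norm_sq
    have hconst : HasFDerivAt (fun y => ‖r y‖ ^ 2) (0 : E →L[ℝ] ℝ) x := by
      refine (hasFDerivAt_const (1 : ℝ) x).congr_of_eventuallyEq ?_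
      filter_upwards [isOpen_ball.mem_nhds hx] with y hy
      rw [hsphere y (ball_subset_closedBall hy)]; norm_num
    have heq := hsq.unique hconst
    have hsurj : Function.Surjective
        ((ContinuousLinearMap.id ℝ E + fderiv ℝ G x : E →L[ℝ] E) : E →ₗ[ℝ] E) := by
      have hu : IsUnit (LinearMap.det
        ((ContinuousLinearMap.id ℝ E + fderiv ℝ G x : E →L[ℝ] E) : E →ₗ[ℝ] E)) :=
        isUnit_iff_ne_zero.2 hne
      exact (LinearEquiv.ofIsUnitDet (v := Module.finBasis ℝ E) (v' := Module.finBasis ℝ E)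
        (f := ((ContinuousLinearMap.id ℝ E + fderiv ℝ G x : E →L[ℝ] E) : E →ₗ[ℝ] E))
        (by rwa [LinearMap.det_toMatrix])).surjective
    obtain ⟨v, hv⟩ := hsurj (r x)
    have h1 := congrArg (fun l : E →L[ℝ] ℝ => l v) heq
    have hv' : (ContinuousLinearMap.id ℝ E + fderiv ℝ G x) v = r x := hv
    simp only [smul_apply, ContinuousLinearMap.comp_apply, hv',
      zero_apply, innerSL_apply_apply, real_inner_self_eq_norm_sq,
      hsphere x (ball_subset_closedBall hx)] at h1
    norm_num at h1
  have hcont : ContinuousOn (fun x => fderiv ℝ G x) (closedBall 0 1) := fun x hx =>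
    ((hGc x hx).continuousAt_fderiv (by simp)).continuousWithinAt
  have hintegral : ∀ t : ℝ, IntegrableOn
      (fun x => (ContinuousLinearMap.id ℝ E + t • fderiv ℝ G x).det) (ball 0 1) μ := by
    intro t
    refine IntegrableOn.mono_set ?_ ball_subset_closedBall
    refine ContinuousOn.integrableOn_compact (isCompact_closedBall 0 1) ?_
    exact ContinuousLinearMap.continuous_det.comp_continuousOn
      (continuousOn_const.add (hcont.const_smul t))
  have hvol : ∀ t ∈ Ioo (0 : ℝ) (1 / (L + 1)),
      ∫ x in ball (0 : E) 1, (ContinuousLinearMap.id ℝ E + t • fderiv ℝ G x).det ∂μ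
        = μ.real (ball 0 1) := by
    intro t ht
    have hL1 : (0 : ℝ) < L + 1 := by positivity
    have htL : t * (L + 1) < 1 := by
      have := ht.2; rwa [lt_div_iff₀ hL1] at this
    have ht1 : t < 1 := by nlinarith [ht.1, L.coe_nonneg]
    have htL' : t * L < 1 := by nlinarith [ht.1]
    let τ : NNReal := ⟨t, ht.1.le⟩
    have hlip : LipschitzWith (τ * L) (fun x => t • (closedBall (0 : E) 1).indicator G x) := by
      have := (lipschitzWith_smul t).comp (lipschitzWith_indicator_closedBall hL hG0)
      have e : ‖t‖₊ = τ := by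
        rw [← NNReal.coe_inj, coe_nnnorm, Real.norm_of_nonneg ht.1.le]; rfl
      rwa [e] at this
    have hτL : τ * L < 1 := by
      rw [← NNReal.coe_lt_coe]; exact htL'
    have himage : (fun x => x + t • G x) '' ball 0 1 = ball 0 1 := by
      apply Subset.antisymm
      · rintro _ ⟨x, hx, rfl⟩
        have hx' : ‖x‖ < 1 := by simpa using hx
        have e : x + t • G x = (1 - t) • x + t • r x := by simp only [hG]; module
        simp only [mem_ball_zero_iff, e]
        refine (norm_add_le _ _).trans_lt ?_
        rw [norm_smul, norm_smul, hsphere x (ball_subset_closedBall hx),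
          Real.norm_of_nonneg ht.1.le,
          Real.norm_of_nonneg (by linarith)]
        nlinarith
      · intro y hy
        obtain ⟨x, hx⟩ := surjective_id_add_of_lipschitz (E := E) hτL hlip y
        simp only at hx
        have hy' : ‖y‖ < 1 := by simpa using hy
        by_cases hx1 : ‖x‖ < 1
        · rw [indicator_of_mem (by simpa using hx1.le)] at hx
          exact ⟨x, by simpa using hx1, hx⟩
        · exfalso
          have : (closedBall (0 : E) 1).indicator G x = 0 := by
            by_cases h : ‖x‖ = 1
            · rw [indicator_of_mem (by simp [h]), hG0 x h]
            · rw [indicator_of_notMem]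
              simpa using lt_of_le_of_ne (not_lt.1 hx1) (Ne.symm h)
          rw [this, smul_zero, add_zero] at hx
          exact hx1 (hx ▸ hy')
    have hinj : InjOn (fun x => x + t • G x) (ball 0 1) := by
      intro x hx y hy hxy
      simp only at hxy
      have h1 : x - y = t • (G y - G x) := by
        rw [smul_sub, sub_eq_sub_iff_add_eq_add, hxy, add_comm]
      have h2 : ‖x - y‖ ≤ t * (L * ‖x - y‖) := by
        have := hL.dist_le_mul y (ball_subset_closedBall hy) x (ball_subset_closedBall hx)
        rw [dist_eq_norm, dist_eq_norm, norm_sub_rev y x] at this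
        calc ‖x - y‖ = t * ‖G y - G x‖ := by rw [h1, norm_smul, Real.norm_of_nonneg ht.1.le]
          _ ≤ _ := mul_le_mul_of_nonneg_left this ht.1.le
      by_contra hne
      have : 0 < ‖x - y‖ := norm_pos_iff.2 (sub_ne_zero.2 hne)
      nlinarith
    have hf' : ∀ x ∈ ball (0 : E) 1, HasFDerivWithinAt (fun x => x + t • G x)
        (ContinuousLinearMap.id ℝ E + t • fderiv ℝ G x) (ball 0 1) x := fun x hx =>
      ((hasFDerivAt_id x).add ((hder x hx).const_smul t)).hasFDerivWithinAt
    have := integral_image_eq_integral_abs_det_fderiv_smul μ measurableSet_ball hf' hinj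
      (fun _ => (1 : ℝ))
    rw [himage] at this
    simp only [smul_eq_mul, mul_one, integral_const,
      measureReal_restrict_apply_univ] at this
    rw [this]
    refine setIntegral_congr_fun measurableSet_ball fun x hx => (abs_of_pos ?_).symm
    refine det_id_add_pos ?_
    rw [norm_smul, Real.norm_of_nonneg ht.1.le]
    exact (mul_le_mul_of_nonneg_left (hnorm x hx) ht.1.le).trans_lt htL'
  obtain ⟨c, v, hv, hc, hp⟩ := exists_extrapolation_weights (Module.finrank ℝ E)
    (show (0 : ℝ) < 1 / (L + 1) by positivity)
  have h0 : ∫ x in ball (0 : E) 1,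
      (ContinuousLinearMap.id ℝ E + (1 : ℝ) • fderiv ℝ G x).det ∂μ = 0 := by
    rw [setIntegral_congr_fun measurableSet_ball hdet1]; simp
  have h1 : ∫ x in ball (0 : E) 1,
      (ContinuousLinearMap.id ℝ E + (1 : ℝ) • fderiv ℝ G x).det ∂μ = μ.real (ball 0 1) := by
    have : ∀ x, (ContinuousLinearMap.id ℝ E + (1 : ℝ) • fderiv ℝ G x).det
        = ∑ i, c i * (ContinuousLinearMap.id ℝ E + v i • fderiv ℝ G x).det := by
      intro x
      obtain ⟨p, hpd, hpe⟩ := exists_polynomial_det_id_add_smul (fderiv ℝ G x)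
      simp_rw [← hpe]
      exact hp p hpd
    simp_rw [this]
    rw [integral_finsetSum _ fun i _ => (hintegral (v i)).const_mul (c i)]
    simp_rw [integral_const_mul]
    rw [Finset.sum_congr rfl fun i _ => by rw [hvol (v i) (hv i)], ← Finset.sum_mul, hc, one_mul]
  have hpos : 0 < μ.real (ball (0 : E) 1) :=
    ENNReal.toReal_pos (measure_ball_pos μ 0 one_pos).ne' measure_ball_lt_top.ne
  linarith [h0.symm.trans h1]

theorem exists_fixedPoint_closedBall_of_contDiff {E : Type*} [NormedAddCommGroup E]
    [InnerProductSpace ℝ E] [FiniteDimensional ℝ E] {g : E → E} (hg : ContDiff ℝ 1 g)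
    (hmaps : ∀ x ∈ closedBall (0 : E) 1, ‖g x‖ ≤ 1) : ∃ x ∈ closedBall (0 : E) 1, g x = x := by
  by_contra! hne
  set w : E → E := fun x => x - g x with hw
  set d : E → ℝ := fun x => (inner ℝ x (w x)) ^ 2 - ‖w x‖ ^ 2 * (‖x‖ ^ 2 - 1) with hd
  set t : E → ℝ := fun x => (-(inner ℝ x (w x)) + √(d x)) / ‖w x‖ ^ 2 with ht
  have hwpos : ∀ x ∈ closedBall (0 : E) 1, 0 < ‖w x‖ ^ 2 := fun x hx => by
    have : w x ≠ 0 := sub_ne_zero.2 (hne x hx).symm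
    positivity
  have hbpos : ∀ x, ‖x‖ = 1 → 0 < (inner ℝ x (w x) : ℝ) := fun x hx => by
    have hx' : x ∈ closedBall (0 : E) 1 := by simp [hx]
    have h1 := hwpos x hx'
    have h2 : ‖w x‖ ^ 2 = ‖x‖ ^ 2 - 2 * inner ℝ x (g x) + ‖g x‖ ^ 2 := norm_sub_sq_real x (g x)
    have h3 : (inner ℝ x (w x) : ℝ) = 1 - inner ℝ x (g x) := by
      rw [hw]; simp only [inner_sub_right, real_inner_self_eq_norm_sq, hx]; norm_num
    have h4 : ‖g x‖ ^ 2 ≤ 1 := by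
      have := hmaps x hx'
      have := norm_nonneg (g x)
      nlinarith
    rw [hx] at h2
    linarith
  have hdpos : ∀ x ∈ closedBall (0 : E) 1, 0 < d x := fun x hx => by
    have hx' : ‖x‖ ≤ 1 := by simpa using hx
    rcases hx'.eq_or_lt with h | h
    · have := hbpos x h
      simp only [hd, h]
      nlinarith
    · have h1 := hwpos x hx
      have h2 : ‖x‖ ^ 2 < 1 := by nlinarith [norm_nonneg x]
      simp only [hd]
      nlinarith [sq_nonneg (inner ℝ x (w x) : ℝ)]
  have hwc : ContDiff ℝ 1 w := contDiff_id.sub hg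
  refine no_contDiff_retraction_sphere (r := fun x => x + t x • w x) ?_ ?_ ?_
  · intro x hx
    have hbc : ContDiff ℝ 1 fun x => (inner ℝ x (w x) : ℝ) := contDiff_id.inner ℝ hwc
    have hnc : ContDiff ℝ 1 fun x => ‖w x‖ ^ 2 := hwc.norm_sq ℝ
    have hdc : ContDiff ℝ 1 d :=
      (hbc.pow 2).sub (hnc.mul ((contDiff_norm_sq ℝ).sub contDiff_const))
    have htc : ContDiffAt ℝ 1 t x :=
      ((hbc.neg.contDiffAt).add (hdc.contDiffAt.sqrt (hdpos x hx).ne')).div hnc.contDiffAt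
        (hwpos x hx).ne'
    exact contDiffAt_id.add (htc.smul hwc.contDiffAt)
  · intro x hx
    have h1 : ‖w x‖ ^ 2 * t x = -(inner ℝ x (w x)) + √(d x) := by
      simp only [ht]
      exact mul_div_cancel₀ _ (hwpos x hx).ne'
    have h2 : √(d x) ^ 2 = d x := Real.sq_sqrt (hdpos x hx).le
    have h3 : ‖x + t x • w x‖ ^ 2
        = ‖x‖ ^ 2 + 2 * (t x * inner ℝ x (w x)) + t x ^ 2 * ‖w x‖ ^ 2 := by
      rw [norm_add_sq_real, inner_smul_right, norm_smul, mul_pow, Real.norm_eq_abs, sq_abs]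
    have h4 : √(d x) = ‖w x‖ ^ 2 * t x + inner ℝ x (w x) := by linarith
    rw [h4] at h2
    simp only [hd] at h2
    have h5 : ‖w x‖ ^ 2 * (‖x + t x • w x‖ ^ 2 - 1) = 0 := by
      rw [h3]; linear_combination h2
    have h6 : ‖x + t x • w x‖ ^ 2 = 1 := by
      rcases mul_eq_zero.1 h5 with h | h
      · exact absurd h (hwpos x hx).ne'
      · linarith
    nlinarith [norm_nonneg (x + t x • w x)]
  · intro x hx
    have : t x = 0 := by
      simp only [ht, hd, hx]
      norm_num
      left
      rw [Real.sqrt_sq (hbpos x hx).le]; ring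
    simp [this]

theorem exists_lipschitz_projection {E : Type*} [NormedAddCommGroup E]
    [InnerProductSpace ℝ E] {K : Set E} (hne : K.Nonempty) (hK : IsComplete K)
    (hconv : Convex ℝ K) :
    ∃ π : E → E, LipschitzWith 1 π ∧ (∀ x, π x ∈ K) ∧ ∀ x ∈ K, π x = x := by
  choose π hπK hπ using exists_norm_eq_iInf_of_complete_convex hne hK hconv
  have hin : ∀ x, ∀ w ∈ K, (inner ℝ (x - π x) (w - π x) : ℝ) ≤ 0 := fun x =>
    (norm_eq_iInf_iff_real_inner_le_zero hconv (hπK x)).1 (hπ x)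
  refine ⟨π, LipschitzWith.of_dist_le_mul fun x y => ?_, hπK, fun x hx => ?_⟩
  · have h1 := hin x (π y) (hπK y)
    have h2 := hin y (π x) (hπK x)
    have h3 : ‖π x - π y‖ ^ 2 ≤ inner ℝ (x - y) (π x - π y) := by
      have e : (inner ℝ (x - y) (π x - π y) : ℝ) - inner ℝ (π x - π y) (π x - π y)
          = - (inner ℝ (x - π x) (π y - π x) + inner ℝ (y - π y) (π x - π y)) := by
        have e1 : π y - π x = -(π x - π y) := by abel
        rw [e1, inner_neg_right, ← inner_sub_left, neg_add, neg_neg, ← sub_eq_add_neg,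
          ← inner_sub_left]
        congr 1; abel
      rw [← real_inner_self_eq_norm_sq]
      linarith
    have h4 : (inner ℝ (x - y) (π x - π y) : ℝ) ≤ ‖x - y‖ * ‖π x - π y‖ := real_inner_le_norm _ _
    rw [dist_eq_norm, dist_eq_norm, NNReal.coe_one, one_mul]
    by_contra! h
    nlinarith [norm_nonneg (x - y), norm_nonneg (π x - π y)]
  · have h := hin x x hx
    rw [real_inner_self_eq_norm_sq] at h
    have : ‖x - π x‖ = 0 := by nlinarith [norm_nonneg (x - π x)]
    exact (sub_eq_zero.1 (norm_eq_zero.1 this)).symm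

/-- **Brouwer's fixed point theorem** for compact convex subsets of the unit ball. -/
theorem brouwer_fixedPoint {E : Type*} [NormedAddCommGroup E] [InnerProductSpace ℝ E]
    [FiniteDimensional ℝ E] {K : Set E} (hne : K.Nonempty) (hK : IsCompact K)
    (hconv : Convex ℝ K) (hball : K ⊆ closedBall 0 1) {f : E → E} (hf : ContinuousOn f K)
    (hmaps : MapsTo f K K) : ∃ x ∈ K, f x = x := by
  obtain ⟨π, hπL, hπK, hπ⟩ := exists_lipschitz_projection hne hK.isComplete hconv
  have hF : UniformContinuous (f ∘ π) := by
    have h1 := hK.uniformContinuousOn_of_continuous hf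
    rw [Metric.uniformContinuousOn_iff] at h1
    rw [Metric.uniformContinuous_iff]
    intro ε hε
    obtain ⟨δ, hδ, h⟩ := h1 ε hε
    refine ⟨δ, hδ, fun {a b} hab => h _ (hπK a) _ (hπK b) ?_⟩
    have := hπL.dist_le_mul a b
    simp only [NNReal.coe_one, one_mul] at this
    exact this.trans_lt hab
  by_contra! hnofix
  have hFfix : ∀ x, (f ∘ π) x ≠ x := by
    intro x hx
    have hxK : x ∈ K := hx ▸ hmaps (hπK x)
    simp only [Function.comp_apply, hπ x hxK] at hx
    exact hnofix x hxK hx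
  have hc : Continuous fun x => ‖(f ∘ π) x - x‖ := (hF.continuous.sub continuous_id).norm
  obtain ⟨x₀, hx₀, hmin⟩ := (isCompact_closedBall (0 : E) 1).exists_isMinOn
    ⟨0, by simp⟩ hc.continuousOn
  set ε := ‖(f ∘ π) x₀ - x₀‖ with hε
  have hεpos : 0 < ε := norm_pos_iff.2 (sub_ne_zero.2 (hFfix x₀))
  obtain ⟨g, hg, hgF⟩ := hF.exists_contDiff_dist_le (show 0 < ε / 3 by positivity)
  have hgn : ∀ x, ‖g x‖ ≤ 1 + ε / 3 := fun x => by
    have h1 : ‖(f ∘ π) x‖ ≤ 1 := by simpa using hball (hmaps (hπK x))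
    have h2 := (hgF x).le
    rw [dist_eq_norm] at h2
    linarith [norm_le_norm_add_norm_sub' (g x) ((f ∘ π) x)]
  obtain ⟨x, hx, hxfix⟩ := exists_fixedPoint_closedBall_of_contDiff
    (g := fun x => (1 + ε / 3)⁻¹ • g x) ((hg.of_le (by simp)).const_smul _) (fun x _ => by
      rw [norm_smul, norm_inv, Real.norm_of_nonneg (by positivity), inv_mul_le_iff₀ (by positivity)]
      simpa using hgn x)
  have h1 : ‖g x - x‖ ≤ ε / 3 := by
    have e : g x - x = (ε / 3) • x := by
      have : g x = (1 + ε / 3) • x := by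
        conv_rhs => rw [← hxfix]
        rw [smul_smul, mul_inv_cancel₀ (by positivity), one_smul]
      rw [this]; module
    rw [e, norm_smul, Real.norm_of_nonneg (by positivity)]
    exact mul_le_of_le_one_right (by positivity) (by simpa using hx)
  have h2 := hgF x
  rw [dist_eq_norm] at h2
  have h3 : ε ≤ ‖(f ∘ π) x - x‖ := hmin hx
  have h4 : ‖(f ∘ π) x - x‖ ≤ ‖(f ∘ π) x - g x‖ + ‖g x - x‖ := by
    simpa using norm_add_le ((f ∘ π) x - g x) (g x - x)
  rw [norm_sub_rev] at h4
  linarith [norm_sub_rev (g x) ((f ∘ π) x), norm_sub_rev x ((f ∘ π) x)]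

/-- **Schauder's fixed point theorem**. -/
theorem schauder_fixedPoint {V : Type*} [NormedAddCommGroup V] [NormedSpace ℝ V] {K : Set V}
    (hne : K.Nonempty) (hK : IsCompact K) (hconv : Convex ℝ K) {F : V → V}
    (hF : ContinuousOn F K) (hmaps : MapsTo F K K) : ∃ x ∈ K, F x = x := by
  have approx : ∀ ε > 0, ∃ x ∈ K, ‖F x - x‖ ≤ ε := by
    intro ε hε
    obtain ⟨t, htK, htfin, hcover⟩ := hK.finite_cover_balls hε
    have htne : t.Nonempty := by
      obtain ⟨y, hy⟩ := hne
      obtain ⟨i, hi, -⟩ := mem_iUnion₂.1 (hcover hy)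
      exact ⟨i, hi⟩
    have : Fintype t := htfin.fintype
    let S : Set (EuclideanSpace ℝ t) := {l | (∀ i, 0 ≤ l i) ∧ ∑ i, l i = 1}
    let P : EuclideanSpace ℝ t → V := fun l => ∑ i, l i • (i : V)
    let wt : t → V → ℝ := fun i y => max 0 (ε - ‖y - i‖)
    let G : EuclideanSpace ℝ t → EuclideanSpace ℝ t := fun l =>
      WithLp.toLp 2 fun i => (∑ j, wt j (F (P l)))⁻¹ * wt i (F (P l))
    have hwt0 : ∀ i y, 0 ≤ wt i y := fun i y => le_max_left _ _
    have hwtpos : ∀ y ∈ K, 0 < ∑ j, wt j y := by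
      intro y hy
      obtain ⟨i, hi, hyi⟩ := mem_iUnion₂.1 (hcover hy)
      refine Finset.sum_pos' (fun i _ => hwt0 i y) ⟨⟨i, hi⟩, Finset.mem_univ _, ?_⟩
      rw [mem_ball, dist_eq_norm] at hyi
      exact lt_max_of_lt_right (by simpa using hyi)
    have hPK : ∀ l ∈ S, P l ∈ K := fun l hl =>
      hconv.sum_mem (fun i _ => hl.1 i) hl.2 (fun i _ => htK i.2)
    have hPc : Continuous P := by
      refine continuous_finsetSum _ fun i _ => ?_
      exact (by fun_prop : Continuous fun l : EuclideanSpace ℝ t => l i).smul continuous_const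
    have hFP : ContinuousOn (fun l => F (P l)) S := hF.comp hPc.continuousOn hPK
    have hSball : S ⊆ closedBall 0 1 := by
      intro l hl
      rw [mem_closedBall_zero_iff, EuclideanSpace.norm_eq]
      refine Real.sqrt_le_one.2 ?_
      calc ∑ i, ‖l i‖ ^ 2 ≤ ∑ i, l i := by
            refine Finset.sum_le_sum fun i _ => ?_
            have h1 : l i ≤ 1 := by
              rw [← hl.2]; exact Finset.single_le_sum (fun j _ => hl.1 j) (Finset.mem_univ i)
            rw [Real.norm_of_nonneg (hl.1 i)]
            nlinarith [hl.1 i]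
        _ = 1 := hl.2
    have hSclosed : IsClosed S := by
      have h1 : IsClosed {l : EuclideanSpace ℝ t | ∀ i, 0 ≤ l i} := by
        simp only [ofPred_forall]
        exact isClosed_iInter fun i => isClosed_le continuous_const (by fun_prop)
      exact h1.inter (isClosed_eq (by fun_prop) continuous_const)
    have hScomp : IsCompact S :=
      (isCompact_closedBall (0 : EuclideanSpace ℝ t) 1).of_isClosed_subset hSclosed hSball
    have hSconv : Convex ℝ S := by
      intro x hx y hy a b ha hb hab
      refine ⟨fun i => ?_, ?_⟩
      · simpa using add_nonneg (mul_nonneg ha (hx.1 i)) (mul_nonneg hb (hy.1 i))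
      · simp [Finset.sum_add_distrib, ← Finset.mul_sum, hx.2, hy.2, hab]
    have hSne : S.Nonempty := by
      obtain ⟨i, hi⟩ := htne
      classical
      refine ⟨EuclideanSpace.single ⟨i, hi⟩ 1, fun j => ?_, ?_⟩
      · rw [PiLp.single_apply]; split_ifs <;> norm_num
      · simp
    have hGc : ContinuousOn G S := by
      refine (PiLp.continuous_toLp 2 _).comp_continuousOn (continuousOn_pi.2 fun i => ?_)
      have hwc : ∀ j, ContinuousOn (fun l => wt j (F (P l))) S := fun j =>
        continuousOn_const.sup (continuousOn_const.sub (hFP.sub continuousOn_const).norm)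
      exact ((continuousOn_finsetSum _ fun j _ => hwc j).inv₀ fun l hl =>
        (hwtpos _ (hmaps (hPK l hl))).ne').mul (hwc i)
    have hGS : MapsTo G S S := by
      intro l hl
      have hp := hwtpos _ (hmaps (hPK l hl))
      refine ⟨fun i => mul_nonneg (inv_nonneg.2 hp.le) (hwt0 _ _), ?_⟩
      simp only [G, ← Finset.mul_sum]
      exact inv_mul_cancel₀ hp.ne'
    obtain ⟨l, hl, hfix⟩ := brouwer_fixedPoint hSne hScomp hSconv hSball hGc hGS
    refine ⟨P l, hPK l hl, ?_⟩
    have e : F (P l) - P l = ∑ i, l i • (F (P l) - (i : V)) := by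
      simp only [smul_sub, Finset.sum_sub_distrib, ← Finset.sum_smul, hl.2, one_smul, P]
    rw [e]
    calc ‖∑ i, l i • (F (P l) - (i : V))‖ ≤ ∑ i, l i * ε := by
          refine (norm_sum_le _ _).trans (Finset.sum_le_sum fun i _ => ?_)
          rw [norm_smul, Real.norm_of_nonneg (hl.1 i)]
          by_cases h : ‖F (P l) - (i : V)‖ ≤ ε
          · exact mul_le_mul_of_nonneg_left h (hl.1 i)
          · have hz : wt i (F (P l)) = 0 := max_eq_left (by linarith)
            have : l i = 0 := by
              have h2 : G l i = 0 := by simp [G, hz]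
              rwa [hfix] at h2
            simp [this]
      _ = ε := by rw [← Finset.sum_mul, hl.2, one_mul]
  have hc : ContinuousOn (fun x => ‖F x - x‖) K := (hF.sub continuousOn_id).norm
  obtain ⟨x, hx, hmin⟩ := hK.exists_isMinOn hne hc
  refine ⟨x, hx, ?_⟩
  by_contra hne'
  have hpos : 0 < ‖F x - x‖ := norm_pos_iff.2 (sub_ne_zero.2 hne')
  obtain ⟨y, hy, hy'⟩ := approx (‖F x - x‖ / 2) (by positivity)
  have h1 : ‖F x - x‖ ≤ ‖F y - y‖ := hmin hy
  linarith

/-- A bounded, uniformly Lipschitz family of continuous functions is compact. -/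
theorem isCompact_setOf_bounded_lipschitz {X : Type*} [PseudoMetricSpace X] [CompactSpace X]
    (R L : ℝ) :
    IsCompact {U : C(X, ℝ) | (∀ x, |U x| ≤ R) ∧ ∀ x y, |U x - U y| ≤ L * dist x y} := by
  have hlip : ∀ h : X → ℝ, (∀ x y, |h x - h y| ≤ L * dist x y) → LipschitzWith L.toNNReal h := by
    intro h hh
    refine LipschitzWith.of_dist_le_mul fun x y => ?_
    rw [Real.dist_eq]
    exact (hh x y).trans (mul_le_mul_of_nonneg_right (Real.le_coe_toNNReal L) dist_nonneg)
  apply ArzelaAscoli.isCompact_of_equicontinuous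
  · have himage : ContinuousMap.toFun '' {U : C(X, ℝ) | (∀ x, |U x| ≤ R) ∧
        ∀ x y, |U x - U y| ≤ L * dist x y} =
        {h : X → ℝ | (∀ x, |h x| ≤ R) ∧ ∀ x y, |h x - h y| ≤ L * dist x y} := by
      ext h
      constructor
      · rintro ⟨U, hU, rfl⟩
        exact hU
      · intro hh
        exact ⟨⟨h, (hlip h hh.2).continuous⟩, hh, rfl⟩
    rw [himage]
    refine (isCompact_univ_pi fun _ : X => isCompact_Icc (a := -R) (b := R)).of_isClosed_subset
      ?_ ?_
    · rw [Set.ofPred_and]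
      simp only [Set.ofPred_forall]
      refine IsClosed.inter (isClosed_iInter fun x => isClosed_le (by fun_prop) (by fun_prop))
        (isClosed_iInter fun x => isClosed_iInter fun y => isClosed_le (by fun_prop) (by fun_prop))
    · intro h hh x _
      exact abs_le.1 (hh.1 x)
  · refine (LipschitzWith.uniformEquicontinuous _ L.toNNReal fun U => ?_).equicontinuous
    exact hlip _ U.2.2

/-- Solutions `(U, k)` of the periodic problem `U' = ψ (k + G U)` with `U 0 = C U`, in integrated
form. -/
def periodicSolutions (T : ℝ) (ψ : ℝ → ℝ) (G : C(Icc 0 T, ℝ) → ℝ → ℝ) (C : C(Icc 0 T, ℝ) → ℝ) :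
    Set (C(Icc 0 T, ℝ) × ℝ) :=
  {p | (∀ t : Icc 0 T, p.1 t = C p.1 + ∫ τ in (0:ℝ)..t, ψ (p.2 + G p.1 τ)) ∧
    ∫ τ in (0:ℝ)..T, ψ (p.2 + G p.1 τ) = 0}

theorem periodicSolutions_nonempty_isCompact {T : ℝ} (hT : 0 < T) {ψ : ℝ → ℝ}
    (hψ : Continuous ψ) (hmono : StrictMono ψ) (hψ0 : ψ 0 = 0) {G : C(Icc 0 T, ℝ) → ℝ → ℝ}
    (hG : Continuous (Function.uncurry G)) {K : ℝ} (hGK : ∀ U, ∀ τ ∈ Icc 0 T, |G U τ| ≤ K)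
    {C : C(Icc 0 T, ℝ) → ℝ} (hC : Continuous C) {R : ℝ} (hCR : ∀ U, |C U| ≤ R) :
    (periodicSolutions T ψ G C).Nonempty ∧ IsCompact (periodicSolutions T ψ G C) := by
  have hK : 0 ≤ K := (abs_nonneg _).trans (hGK 0 0 ⟨le_rfl, hT.le⟩)
  have hψpos : ∀ x, 0 < x → 0 < ψ x := fun x hx => by simpa [hψ0] using hmono hx
  have hψneg : ∀ x, x < 0 → ψ x < 0 := fun x hx => by simpa [hψ0] using hmono hx
  have hψnonneg : ∀ x, 0 ≤ x → 0 ≤ ψ x := fun x hx => by simpa [hψ0] using hmono.monotone hx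
  have hψnonpos : ∀ x, x ≤ 0 → ψ x ≤ 0 := fun x hx => by simpa [hψ0] using hmono.monotone hx
  have hcont : ∀ (U : C(Icc 0 T, ℝ)) k, Continuous fun τ => ψ (k + G U τ) := fun U k =>
    hψ.comp (continuous_const.add (hG.comp (by fun_prop : Continuous fun τ : ℝ => (U, τ))))
  have hprim : Continuous fun p : (C(Icc 0 T, ℝ) × ℝ) × ℝ =>
      ∫ τ in (0:ℝ)..p.2, ψ (p.1.2 + G p.1.1 τ) := by
    apply intervalIntegral.continuous_parametric_primitive_of_continuous
      (f := fun (p : C(Icc 0 T, ℝ) × ℝ) τ => ψ (p.2 + G p.1 τ))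
    exact hψ.comp ((by fun_prop : Continuous fun x : (C(Icc 0 T, ℝ) × ℝ) × ℝ => x.1.2).add
      (hG.comp (by fun_prop : Continuous fun x : (C(Icc 0 T, ℝ) × ℝ) × ℝ => (x.1.1, x.2))))
  set N : C(Icc 0 T, ℝ) × ℝ → ℝ → ℝ := fun p t => ∫ τ in (0:ℝ)..t, ψ (p.2 + G p.1 τ) with hN
  have hNT : Continuous fun p => N p T := hprim.comp (by fun_prop : Continuous fun p => (p, T))
  set L : ℝ := max (ψ (2 * K)) (-ψ (-(2 * K))) with hL
  have hL0 : 0 ≤ L := by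
    exact le_max_of_le_left (hψnonneg _ (by linarith))
  have hbound : ∀ (U : C(Icc 0 T, ℝ)) k, |k| ≤ K → ∀ τ ∈ Icc 0 T, |ψ (k + G U τ)| ≤ L := by
    intro U k hk τ hτ
    have h1 := abs_le.1 hk
    have h2 := abs_le.1 (hGK U τ hτ)
    rw [abs_le]
    constructor
    · have := hmono.monotone (show -(2 * K) ≤ k + G U τ by linarith)
      have := le_max_right (ψ (2 * K)) (-ψ (-(2 * K)))
      linarith
    · exact (hmono.monotone (show k + G U τ ≤ 2 * K by linarith)).trans (le_max_left _ _)
  have hNlip : ∀ p : C(Icc 0 T, ℝ) × ℝ, |p.2| ≤ K → ∀ t ∈ Icc 0 T, ∀ t' ∈ Icc 0 T,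
      |N p t - N p t'| ≤ L * |t - t'| := by
    intro p hp t ht t' ht'
    rw [hN]
    simp only
    rw [intervalIntegral.integral_interval_sub_left ((hcont _ _).intervalIntegrable _ _)
      ((hcont _ _).intervalIntegrable _ _)]
    rw [← Real.norm_eq_abs]
    apply intervalIntegral.norm_integral_le_of_norm_le_const
    intro τ hτ
    exact hbound _ _ hp τ (uIcc_subset_Icc ht' ht (uIoc_subset_uIcc hτ))
  have hN0 : ∀ p, N p 0 = 0 := fun p => intervalIntegral.integral_same
  set S : Set (C(Icc 0 T, ℝ) × ℝ) :=
    {U | (∀ x, |U x| ≤ R + L * T) ∧ ∀ x y, |U x - U y| ≤ L * dist x y} ×ˢ Icc (-K) K with hS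
  have hScomp : IsCompact S := (isCompact_setOf_bounded_lipschitz _ _).prod isCompact_Icc
  set V : C(Icc 0 T, ℝ) × ℝ → C(Icc 0 T, ℝ) := fun p =>
    ⟨fun t => C p.1 + N p t, continuous_const.add
      (hprim.comp (by fun_prop : Continuous fun t : Icc 0 T => (p, (t : ℝ))))⟩ with hV
  have hVcont : Continuous V := by
    apply ContinuousMap.continuous_of_continuous_uncurry
    exact (hC.comp (by fun_prop)).add (hprim.comp
      (by fun_prop : Continuous fun x : (C(Icc 0 T, ℝ) × ℝ) × Icc 0 T => (x.1, (x.2 : ℝ))))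
  have hVmem : ∀ p : C(Icc 0 T, ℝ) × ℝ, |p.2| ≤ K →
      (∀ x, |V p x| ≤ R + L * T) ∧ ∀ x y, |V p x - V p y| ≤ L * dist x y := by
    intro p hp
    refine ⟨fun x => ?_, fun x y => ?_⟩
    · have h1 := hNlip p hp x x.2 0 ⟨le_rfl, hT.le⟩
      rw [hN0, sub_zero, sub_zero, abs_of_nonneg x.2.1] at h1
      have h2 : L * x ≤ L * T := mul_le_mul_of_nonneg_left x.2.2 hL0
      calc |C p.1 + N p x| ≤ |C p.1| + |N p x| := abs_add_le _ _
        _ ≤ R + L * T := add_le_add (hCR _) (h1.trans h2)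
    · have : V p x - V p y = N p x - N p y := by simp [hV]
      rw [this]
      exact hNlip p hp x x.2 y y.2
  have hchar : periodicSolutions T ψ G C = {p | p ∈ S ∧ V p = p.1 ∧ N p T = 0} := by
    ext p
    constructor
    · rintro ⟨h1, h2⟩
      have hk : |p.2| ≤ K := by
        by_contra hlt
        push Not at hlt
        rcases lt_abs.1 hlt with h | h
        · have : 0 < ∫ τ in (0:ℝ)..T, ψ (p.2 + G p.1 τ) := by
            apply intervalIntegral.intervalIntegral_pos_of_pos_on
              ((hcont _ _).intervalIntegrable _ _) _ hT
            intro τ hτ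
            have := (abs_le.1 (hGK p.1 τ (Ioo_subset_Icc_self hτ))).1
            exact hψpos _ (by linarith)
          linarith
        · have : 0 < ∫ τ in (0:ℝ)..T, -ψ (p.2 + G p.1 τ) := by
            apply intervalIntegral.intervalIntegral_pos_of_pos_on
              ((hcont _ _).neg.intervalIntegrable _ _) _ hT
            intro τ hτ
            have := (abs_le.1 (hGK p.1 τ (Ioo_subset_Icc_self hτ))).2
            exact neg_pos.2 (hψneg _ (by linarith))
          rw [intervalIntegral.integral_neg] at this
          linarith
      have hVp : V p = p.1 := by
        ext t
        exact (h1 t).symm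
      refine ⟨⟨?_, abs_le.1 hk⟩, hVp, h2⟩
      have := hVmem p hk
      rwa [hVp] at this
    · rintro ⟨_, h1, h2⟩
      refine ⟨fun t => ?_, h2⟩
      conv_lhs => rw [← h1]
      rfl
  constructor
  · have hfix := schauder_fixedPoint (K := S) (F := fun p => (V p, max (-K) (min (p.2 - N p T) K)))
      ?_ hScomp ?_ ?_ ?_
    · obtain ⟨p, hp, hpeq⟩ := hfix
      refine ⟨p, ?_⟩
      rw [hchar]
      have h1 : V p = p.1 := congrArg Prod.fst hpeq
      have h2 : max (-K) (min (p.2 - N p T) K) = p.2 := congrArg Prod.snd hpeq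
      refine ⟨hp, h1, ?_⟩
      have hpos : p.2 = K → 0 ≤ N p T := by
        intro hk
        apply intervalIntegral.integral_nonneg hT.le
        intro τ hτ
        have := (abs_le.1 (hGK p.1 τ hτ)).1
        exact hψnonneg _ (by linarith)
      have hneg : p.2 = -K → N p T ≤ 0 := by
        intro hk
        rw [← neg_nonneg, ← intervalIntegral.integral_neg]
        apply intervalIntegral.integral_nonneg hT.le
        intro τ hτ
        have := (abs_le.1 (hGK p.1 τ hτ)).2
        exact neg_nonneg.2 (hψnonpos _ (by linarith))
      rcases le_total (p.2 - N p T) K with h3 | h3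
      · rw [min_eq_left h3] at h2
        rcases le_total (-K) (p.2 - N p T) with h4 | h4
        · rw [max_eq_right h4] at h2
          linarith
        · rw [max_eq_left h4] at h2
          have := hneg h2.symm
          linarith
      · rw [min_eq_right h3, max_eq_right (by linarith)] at h2
        have := hpos h2.symm
        linarith
    · have := hVmem (0, 0) (by simpa using hK)
      exact ⟨(V (0, 0), 0), this, by simpa using hK, hK⟩
    · refine Convex.prod ?_ (convex_Icc _ _)
      intro U hU W hW α β hα hβ hαβ
      refine ⟨fun x => ?_, fun x y => ?_⟩
      · have h1 := abs_le.1 (hU.1 x)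
        have h2 := abs_le.1 (hW.1 x)
        simp only [ContinuousMap.add_apply, ContinuousMap.smul_apply, smul_eq_mul, abs_le]
        have hβ' : β = 1 - α := by linarith
        subst hβ'
        constructor <;> nlinarith
      · have h1 := abs_le.1 (hU.2 x y)
        have h2 := abs_le.1 (hW.2 x y)
        simp only [ContinuousMap.add_apply, ContinuousMap.smul_apply, smul_eq_mul, abs_le]
        have hβ' : β = 1 - α := by linarith
        subst hβ'
        constructor <;> nlinarith
    · exact (hVcont.prodMk (continuous_const.max
        ((continuous_snd.sub hNT).min continuous_const))).continuousOn
    · intro p hp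
      exact ⟨hVmem p (abs_le.2 hp.2), le_max_left _ _, max_le (by linarith) (min_le_right _ _)⟩
  · rw [hchar]
    refine hScomp.inter_right (IsClosed.inter ?_ ?_)
    · exact isClosed_eq hVcont continuous_fst
    · exact isClosed_eq hNT continuous_const

/-- Data of the equation `(φ(u'))' + f(u)u' + a(t)q(u) = s + e(t)`, with coefficients `a` and `e`
that are bounded everywhere. -/
structure WEProblem where
  T : ℝ
  φ : ℝ → ℝ
  f : ℝ → ℝ
  q : ℝ → ℝ
  a : ℝ → ℝ
  e : ℝ → ℝ
  A : ℝ
  T_pos : 0 < T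
  φ_mono : StrictMono φ
  φ_cont : Continuous φ
  φ_surj : Function.Surjective φ
  φ_zero : φ 0 = 0
  f_cont : Continuous f
  q_cont : Continuous q
  a_meas : Measurable a
  e_meas : Measurable e
  a_nonneg : ∀ t, 0 ≤ a t
  a_le : ∀ t, a t ≤ A
  e_le : ∀ t, |e t| ≤ A
  a_pos : 0 < ∫ t in (0:ℝ)..T, a t
  e_mean : ∫ t in (0:ℝ)..T, e t = 0

namespace WEProblem

/-- The inverse of the homeomorphism `φ`. -/
noncomputable def ψ (P : WEProblem) : ℝ → ℝ :=
  (P.φ_mono.orderIsoOfSurjective P.φ P.φ_surj).symm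

theorem φ_ψ (P : WEProblem) (x : ℝ) : P.φ (P.ψ x) = x :=
  (P.φ_mono.orderIsoOfSurjective P.φ P.φ_surj).apply_symm_apply x

theorem ψ_φ (P : WEProblem) (x : ℝ) : P.ψ (P.φ x) = x :=
  (P.φ_mono.orderIsoOfSurjective P.φ P.φ_surj).symm_apply_apply x

theorem ψ_cont (P : WEProblem) : Continuous P.ψ :=
  (P.φ_mono.orderIsoOfSurjective P.φ P.φ_surj).symm.continuous

theorem ψ_mono (P : WEProblem) : StrictMono P.ψ :=
  (P.φ_mono.orderIsoOfSurjective P.φ P.φ_surj).symm.strictMono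

theorem ψ_zero (P : WEProblem) : P.ψ 0 = 0 := by
  conv_lhs => rw [← P.φ_zero]
  exact P.ψ_φ 0

/-- The primitive of `f` vanishing at `0`. -/
noncomputable def F (P : WEProblem) (x : ℝ) : ℝ := ∫ y in (0:ℝ)..x, P.f y

theorem F_hasDerivAt (P : WEProblem) (x : ℝ) : HasDerivAt P.F (P.f x) x :=
  P.f_cont.integral_hasStrictDerivAt 0 x |>.hasDerivAt

theorem F_cont (P : WEProblem) : Continuous P.F :=
  continuous_iff_continuousAt.2 fun x => (P.F_hasDerivAt x).continuousAt

theorem A_nonneg (P : WEProblem) : 0 ≤ P.A := (P.a_nonneg 0).trans (P.a_le 0)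

/-- The integral of the weight `a` over a period. -/
noncomputable def aI (P : WEProblem) : ℝ := ∫ t in (0:ℝ)..P.T, P.a t

theorem aI_pos (P : WEProblem) : 0 < P.aI := P.a_pos

theorem a_abs_le (P : WEProblem) (t : ℝ) : |P.a t| ≤ P.A := by
  rw [abs_of_nonneg (P.a_nonneg t)]
  exact P.a_le t

theorem intervalIntegrable_of_abs_le {h : ℝ → ℝ} (hm : Measurable h) {C : ℝ}
    (hC : ∀ t, |h t| ≤ C) (x y : ℝ) : IntervalIntegrable h volume x y :=
  (intervalIntegrable_const (c := C)).mono_fun hm.aestronglyMeasurable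
    (Eventually.of_forall fun t => by
      exact (hC t).trans (le_abs_self C))

theorem a_int (P : WEProblem) (x y : ℝ) : IntervalIntegrable P.a volume x y :=
  intervalIntegrable_of_abs_le P.a_meas P.a_abs_le x y

theorem e_int (P : WEProblem) (x y : ℝ) : IntervalIntegrable P.e volume x y :=
  intervalIntegrable_of_abs_le P.e_meas P.e_le x y

theorem a_mul_int (P : WEProblem) {h : ℝ → ℝ} (hh : Continuous h) (x y : ℝ) :
    IntervalIntegrable (fun τ => P.a τ * h τ) volume x y :=
  (P.a_int x y).mul_continuousOn hh.continuousOn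

/-- The forcing term of the truncated equation, in which `u` is replaced by `g ∘ u`. -/
def rhs (P : WEProblem) (g : ℝ → ℝ) (s : ℝ) (u : ℝ → ℝ) (τ : ℝ) : ℝ :=
  s + P.e τ - P.a τ * P.q (g (u τ))

theorem rhs_int (P : WEProblem) {g u : ℝ → ℝ} (hg : Continuous g) (hu : Continuous u) (s x y : ℝ) :
    IntervalIntegrable (P.rhs g s u) volume x y :=
  (intervalIntegrable_const.add (P.e_int x y)).sub
    (P.a_mul_int (P.q_cont.comp (hg.comp hu)) x y)

theorem integral_rhs (P : WEProblem) {g u : ℝ → ℝ} (hg : Continuous g) (hu : Continuous u)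
    (s x y : ℝ) :
    ∫ τ in x..y, P.rhs g s u τ =
      (y - x) * s + (∫ τ in x..y, P.e τ) - ∫ τ in x..y, P.a τ * P.q (g (u τ)) := by
  unfold rhs
  have hq : Continuous fun τ => P.q (g (u τ)) := P.q_cont.comp (hg.comp hu)
  rw [intervalIntegral.integral_sub (intervalIntegrable_const.add (P.e_int x y))
    (P.a_mul_int hq x y),
    intervalIntegral.integral_add intervalIntegrable_const (P.e_int x y),
    intervalIntegral.integral_const, smul_eq_mul]

/-- `u` is a periodic solution, in integrated form, of the truncated equation
`(φ(u'))' + (F(g(u)))' + a(t)q(g(u)) = s + e(t)`. -/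
structure IsInt (P : WEProblem) (g : ℝ → ℝ) (s : ℝ) (u u' : ℝ → ℝ) (k : ℝ) : Prop where
  hasDerivAt : ∀ t, HasDerivAt u (u' t) t
  cont' : Continuous u'
  per : u 0 = u P.T
  eq : ∀ t ∈ Icc 0 P.T, P.φ (u' t) = k - P.F (g (u t)) + ∫ τ in (0:ℝ)..t, P.rhs g s u τ
  mean : ∫ τ in (0:ℝ)..P.T, P.rhs g s u τ = 0

theorem IsInt.cont {P : WEProblem} {g : ℝ → ℝ} {s : ℝ} {u u' : ℝ → ℝ} {k : ℝ}
    (h : P.IsInt g s u u' k) : Continuous u :=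
  continuous_iff_continuousAt.2 fun x => (h.hasDerivAt x).continuousAt

theorem IsInt.mul_T {P : WEProblem} {g : ℝ → ℝ} {s : ℝ} {u u' : ℝ → ℝ} {k : ℝ}
    (h : P.IsInt g s u u' k) (hg : Continuous g) :
    P.T * s = ∫ τ in (0:ℝ)..P.T, P.a τ * P.q (g (u τ)) := by
  have := h.mean
  rw [P.integral_rhs hg h.cont, P.e_mean] at this
  linarith

theorem IsInt.per' {P : WEProblem} {g : ℝ → ℝ} {s : ℝ} {u u' : ℝ → ℝ} {k : ℝ}
    (h : P.IsInt g s u u' k) : u' 0 = u' P.T := by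
  apply P.φ_mono.injective
  rw [h.eq 0 ⟨le_rfl, P.T_pos.le⟩, h.eq P.T ⟨P.T_pos.le, le_rfl⟩, h.mean, ← h.per]
  simp

theorem integral_rhs_congr (P : WEProblem) {g g₁ u v : ℝ → ℝ} (s : ℝ)
    (h : ∀ t ∈ Icc 0 P.T, g (u t) = g₁ (v t)) {t : ℝ} (ht : t ∈ Icc 0 P.T) :
    ∫ τ in (0:ℝ)..t, P.rhs g s u τ = ∫ τ in (0:ℝ)..t, P.rhs g₁ s v τ := by
  apply intervalIntegral.integral_congr
  intro τ hτ
  rw [uIcc_of_le ht.1] at hτ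
  simp only [rhs, h τ ⟨hτ.1, hτ.2.trans ht.2⟩]

/-- Changing the truncation outside the range of the solution is harmless. -/
theorem IsInt.congr {P : WEProblem} {g g₁ : ℝ → ℝ} {s : ℝ} {u u' : ℝ → ℝ} {k : ℝ}
    (h : P.IsInt g s u u' k) (hg : ∀ t ∈ Icc 0 P.T, g (u t) = g₁ (u t)) :
    P.IsInt g₁ s u u' k where
  hasDerivAt := h.hasDerivAt
  cont' := h.cont'
  per := h.per
  eq t ht := by
    rw [h.eq t ht, hg t ht, P.integral_rhs_congr s hg ht]
  mean := by
    exact (P.integral_rhs_congr s hg ⟨P.T_pos.le, le_rfl⟩).symm.trans h.mean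

/-- Extension of a function on `[0, T]` to the line, constant outside `[0, T]`. -/
noncomputable def ext (P : WEProblem) (U : C(Icc 0 P.T, ℝ)) : ℝ → ℝ :=
  IccExtend P.T_pos.le U

theorem ext_cont (P : WEProblem) : Continuous (Function.uncurry P.ext) := by
  have : Continuous fun p : C(Icc 0 P.T, ℝ) × ℝ => p.1 (projIcc 0 P.T P.T_pos.le p.2) :=
    continuous_eval.comp (continuous_fst.prodMk
      ((continuous_projIcc (h := P.T_pos.le)).comp continuous_snd))
  exact this

theorem ext_cont_right (P : WEProblem) (U : C(Icc 0 P.T, ℝ)) : Continuous (P.ext U) :=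
  P.ext_cont.comp (by fun_prop : Continuous fun τ : ℝ => (U, τ))

theorem ext_cont_left (P : WEProblem) (τ : ℝ) : Continuous fun U => P.ext U τ :=
  P.ext_cont.comp (by fun_prop : Continuous fun U : C(Icc 0 P.T, ℝ) => (U, τ))

theorem ext_of_mem (P : WEProblem) (U : C(Icc 0 P.T, ℝ)) {t : ℝ} (ht : t ∈ Icc 0 P.T) :
    P.ext U t = U ⟨t, ht⟩ :=
  IccExtend_of_mem _ _ ht

/-- The value of the parameter `s` compatible with the mean value condition. -/
noncomputable def sval (P : WEProblem) (g : ℝ → ℝ) (U : C(Icc 0 P.T, ℝ)) : ℝ :=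
  (∫ τ in (0:ℝ)..P.T, P.a τ * P.q (g (P.ext U τ))) / P.T

/-- The nonlinear integral operator of the truncated problem. -/
noncomputable def G (P : WEProblem) (g : ℝ → ℝ) (U : C(Icc 0 P.T, ℝ)) (t : ℝ) : ℝ :=
  -P.F (g (P.ext U t)) + ∫ τ in (0:ℝ)..t, P.rhs g (P.sval g U) (P.ext U) τ

theorem exists_bound_comp {h g : ℝ → ℝ} (hh : Continuous h) {M : ℝ} (hgM : ∀ x, |g x| ≤ M) :
    ∃ B, 0 ≤ B ∧ ∀ x, |h (g x)| ≤ B := by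
  obtain ⟨B, hB⟩ := (isCompact_Icc (a := -M) (b := M)).exists_bound_of_continuousOn hh.continuousOn
  refine ⟨B, (norm_nonneg _).trans (hB (g 0) (abs_le.1 (hgM 0))), fun x => ?_⟩
  exact hB (g x) (abs_le.1 (hgM x))

theorem continuous_integral_a_mul (P : WEProblem) {g : ℝ → ℝ} (hg : Continuous g) {M : ℝ}
    (hgM : ∀ x, |g x| ≤ M) :
    Continuous fun p : C(Icc 0 P.T, ℝ) × ℝ => ∫ τ in (0:ℝ)..p.2, P.a τ * P.q (g (P.ext p.1 τ)) := by
  obtain ⟨B, hB0, hB⟩ := exists_bound_comp P.q_cont hgM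
  rw [continuous_iff_continuousAt]
  rintro ⟨U, t⟩
  have hcont : ∀ V, Continuous fun τ => P.q (g (P.ext V τ)) := fun V =>
    P.q_cont.comp (hg.comp (P.ext_cont_right V))
  apply intervalIntegral.continuousAt_parametric_primitive_of_dominated
    (F := fun V τ => P.a τ * P.q (g (P.ext V τ))) (fun _ => P.A * B) (-|t| - 1) (|t| + 1)
  · intro V
    exact (P.a_meas.mul (hcont V).measurable).aestronglyMeasurable
  · refine Eventually.of_forall fun V => Eventually.of_forall fun τ => ?_
    rw [Real.norm_eq_abs, abs_mul]
    exact mul_le_mul (P.a_abs_le τ) (hB _) (abs_nonneg _) P.A_nonneg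
  · exact intervalIntegrable_const
  · refine Eventually.of_forall fun τ => Continuous.continuousAt ?_
    exact continuous_const.mul (P.q_cont.comp (hg.comp (P.ext_cont_left τ)))
  · constructor <;> linarith [abs_nonneg t]
  · constructor <;> linarith [neg_abs_le t, le_abs_self t]
  · exact Real.volume_singleton

theorem sval_cont (P : WEProblem) {g : ℝ → ℝ} (hg : Continuous g) {M : ℝ}
    (hgM : ∀ x, |g x| ≤ M) : Continuous (P.sval g) :=
  ((P.continuous_integral_a_mul hg hgM).comp
    (by fun_prop : Continuous fun U : C(Icc 0 P.T, ℝ) => (U, P.T))).div_const _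

theorem G_cont (P : WEProblem) {g : ℝ → ℝ} (hg : Continuous g) {M : ℝ}
    (hgM : ∀ x, |g x| ≤ M) : Continuous (Function.uncurry (P.G g)) := by
  have h : Function.uncurry (P.G g) = fun p : C(Icc 0 P.T, ℝ) × ℝ =>
      -P.F (g (P.ext p.1 p.2)) + ((p.2 - 0) * P.sval g p.1 + (∫ τ in (0:ℝ)..p.2, P.e τ) -
        ∫ τ in (0:ℝ)..p.2, P.a τ * P.q (g (P.ext p.1 τ))) := by
    ext p
    simp only [Function.uncurry, G]
    rw [P.integral_rhs hg (P.ext_cont_right _)]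
  rw [h]
  have hext : Continuous fun p : C(Icc 0 P.T, ℝ) × ℝ => P.ext p.1 p.2 := P.ext_cont
  have he : Continuous fun x : ℝ => ∫ τ in (0:ℝ)..x, P.e τ :=
    intervalIntegral.continuous_primitive (fun x y => P.e_int x y) 0
  exact (P.F_cont.comp (hg.comp hext)).neg.add
    ((((continuous_snd.sub continuous_const).mul ((P.sval_cont hg hgM).comp continuous_fst)).add
      (he.comp continuous_snd)).sub (P.continuous_integral_a_mul hg hgM))

theorem G_bound (P : WEProblem) {g : ℝ → ℝ} {M : ℝ} (hgM : ∀ x, |g x| ≤ M) :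
    ∃ K, ∀ U, ∀ τ ∈ Icc 0 P.T, |P.G g U τ| ≤ K := by
  obtain ⟨B, hB0, hB⟩ := exists_bound_comp P.q_cont hgM
  obtain ⟨B', hB'0, hB'⟩ := exists_bound_comp P.F_cont hgM
  have hmul : ∀ U τ, |P.a τ * P.q (g (P.ext U τ))| ≤ P.A * B := fun U τ => by
    rw [abs_mul]
    exact mul_le_mul (P.a_abs_le τ) (hB _) (abs_nonneg _) P.A_nonneg
  have hs : ∀ U, |P.sval g U| ≤ P.A * B := by
    intro U
    unfold sval
    rw [abs_div, abs_of_pos P.T_pos, div_le_iff₀ P.T_pos, ← Real.norm_eq_abs]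
    have := intervalIntegral.norm_integral_le_of_norm_le_const (a := 0) (b := P.T)
      (f := fun τ => P.a τ * P.q (g (P.ext U τ))) (C := P.A * B) fun τ _ => hmul U τ
    rwa [sub_zero, abs_of_pos P.T_pos] at this
  refine ⟨B' + (P.A * B + P.A + P.A * B) * P.T, fun U t ht => ?_⟩
  unfold G
  refine (abs_add_le _ _).trans (add_le_add (by rw [abs_neg]; exact hB' _) ?_)
  have h := intervalIntegral.norm_integral_le_of_norm_le_const (a := 0) (b := t)
    (f := P.rhs g (P.sval g U) (P.ext U)) (C := P.A * B + P.A + P.A * B) fun τ _ => by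
      unfold rhs
      refine (norm_sub_le _ _).trans (add_le_add ((norm_add_le _ _).trans
        (add_le_add (hs U) (P.e_le τ))) (hmul U τ))
  rw [sub_zero, abs_of_nonneg ht.1, Real.norm_eq_abs] at h
  have hA := P.A_nonneg
  exact h.trans (mul_le_mul_of_nonneg_left ht.2 (by positivity))

theorem isInt_of_mem_periodicSolutions (P : WEProblem) {g : ℝ → ℝ} (hg : Continuous g) {M : ℝ}
    (hgM : ∀ x, |g x| ≤ M) {C : C(Icc 0 P.T, ℝ) → ℝ} {p : C(Icc 0 P.T, ℝ) × ℝ}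
    (hp : p ∈ periodicSolutions P.T P.ψ (P.G g) C) :
    ∃ u u', P.IsInt g (P.sval g p.1) u u' p.2 ∧ (∀ t : Icc 0 P.T, p.1 t = u t) ∧ u 0 = C p.1 := by
  have hcont : Continuous fun τ => P.ψ (p.2 + P.G g p.1 τ) :=
    P.ψ_cont.comp (continuous_const.add
      ((P.G_cont hg hgM).comp (by fun_prop : Continuous fun τ : ℝ => (p.1, τ))))
  obtain ⟨h1, h2⟩ := hp
  have hext : ∀ t ∈ Icc 0 P.T,
      g (C p.1 + ∫ τ in (0:ℝ)..t, P.ψ (p.2 + P.G g p.1 τ)) = g (P.ext p.1 t) := by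
    intro t ht
    rw [P.ext_of_mem _ ht, h1]
  refine ⟨fun t => C p.1 + ∫ τ in (0:ℝ)..t, P.ψ (p.2 + P.G g p.1 τ),
    fun t => P.ψ (p.2 + P.G g p.1 t), ⟨fun t => ?_, hcont, ?_, fun t ht => ?_, ?_⟩, h1, ?_⟩
  · exact (hcont.integral_hasStrictDerivAt 0 t).hasDerivAt.const_add _
  · simp [h2]
  · rw [P.integral_rhs_congr _ hext ht, P.φ_ψ, hext t ht, G]
    ring
  · rw [P.integral_rhs_congr _ hext ⟨P.T_pos.le, le_rfl⟩, P.integral_rhs hg (P.ext_cont_right _),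
      P.e_mean, sval, sub_zero, mul_div_cancel₀ _ P.T_pos.ne']
    ring
  · simp

theorem IsInt.mem_periodicSolutions {P : WEProblem} {g : ℝ → ℝ} (hg : Continuous g) {s : ℝ}
    {u u' : ℝ → ℝ} {k : ℝ} (h : P.IsInt g s u u' k) {C : C(Icc 0 P.T, ℝ) → ℝ}
    {U : C(Icc 0 P.T, ℝ)} (hU : ∀ t : Icc 0 P.T, U t = u t) (hC : C U = u 0) :
    (U, k) ∈ periodicSolutions P.T P.ψ (P.G g) C ∧ P.sval g U = s := by
  have hext : ∀ t ∈ Icc 0 P.T, g (P.ext U t) = g (u t) := by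
    intro t ht
    rw [P.ext_of_mem _ ht, hU]
  have hs : P.sval g U = s := by
    unfold sval
    rw [div_eq_iff P.T_pos.ne', mul_comm, h.mul_T hg]
    apply intervalIntegral.integral_congr
    intro τ hτ
    rw [uIcc_of_le P.T_pos.le] at hτ
    simp only [hext τ hτ]
  have hu' : ∀ t ∈ Icc 0 P.T, P.ψ (k + P.G g U t) = u' t := by
    intro t ht
    apply P.φ_mono.injective
    rw [P.φ_ψ, h.eq t ht, G, hs, hext t ht, P.integral_rhs_congr s hext ht]
    ring
  have hintegral : ∀ t ∈ Icc 0 P.T, ∫ τ in (0:ℝ)..t, P.ψ (k + P.G g U τ) = u t - u 0 := by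
    intro t ht
    rw [← intervalIntegral.integral_eq_sub_of_hasDerivAt (fun x _ => h.hasDerivAt x)
      (h.cont'.intervalIntegrable _ _)]
    apply intervalIntegral.integral_congr
    intro τ hτ
    rw [uIcc_of_le ht.1] at hτ
    exact hu' τ ⟨hτ.1, hτ.2.trans ht.2⟩
  refine ⟨⟨fun t => ?_, ?_⟩, hs⟩
  · simp only
    rw [hintegral t t.2, hC, hU]
    ring
  · simp only
    rw [hintegral P.T ⟨P.T_pos.le, le_rfl⟩, ← h.per, sub_self]

theorem exists_isInt (P : WEProblem) {g : ℝ → ℝ} (hg : Continuous g) {M : ℝ}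
    (hgM : ∀ x, |g x| ≤ M) {C : C(Icc 0 P.T, ℝ) → ℝ → ℝ} (hC : Continuous (Function.uncurry C))
    {R : ℝ} (hCR : ∀ U s, |C U s| ≤ R) :
    ∃ s u u' k, ∃ U : C(Icc 0 P.T, ℝ), P.IsInt g s u u' k ∧ (∀ t : Icc 0 P.T, U t = u t) ∧
      u 0 = C U s := by
  obtain ⟨K, hK⟩ := P.G_bound hgM
  obtain ⟨p, hp⟩ := (periodicSolutions_nonempty_isCompact P.T_pos P.ψ_cont P.ψ_mono P.ψ_zero
    (P.G_cont hg hgM) hK (C := fun U => C U (P.sval g U))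
    (hC.comp (continuous_id.prodMk (P.sval_cont hg hgM))) (fun U => hCR U _)).1
  obtain ⟨u, u', h, hU, h0⟩ := P.isInt_of_mem_periodicSolutions hg hgM hp
  exact ⟨_, u, u', _, p.1, h, hU, h0⟩

/-- Among the periodic solutions of a truncated equation with bounded initial value, there is one
with the smallest parameter. -/
theorem exists_isInt_minimal (P : WEProblem) {g : ℝ → ℝ} (hg : Continuous g) {M : ℝ}
    (hgM : ∀ x, |g x| ≤ M) {R : ℝ} (hR : 0 ≤ R) :
    ∃ s u u' k, P.IsInt g s u u' k ∧ |u 0| ≤ R ∧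
      ∀ s₁ v v' k₁, P.IsInt g s₁ v v' k₁ → |v 0| ≤ R → s ≤ s₁ := by
  obtain ⟨K, hK⟩ := P.G_bound hgM
  have h0mem : (0:ℝ) ∈ Icc 0 P.T := ⟨le_rfl, P.T_pos.le⟩
  set C : C(Icc 0 P.T, ℝ) → ℝ := fun U => max (-R) (min (U ⟨0, h0mem⟩) R) with hCdef
  have hC : Continuous C := by fun_prop
  have hCR : ∀ U, |C U| ≤ R := fun U =>
    abs_le.2 ⟨le_max_left _ _, max_le (by linarith) (min_le_right _ _)⟩
  obtain ⟨hne, hcomp⟩ := periodicSolutions_nonempty_isCompact P.T_pos P.ψ_cont P.ψ_mono P.ψ_zero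
    (P.G_cont hg hgM) hK hC hCR
  obtain ⟨p, hp, hmin⟩ := hcomp.exists_isMinOn hne
    ((P.sval_cont hg hgM).comp continuous_fst).continuousOn
  obtain ⟨u, u', h, hU, h0⟩ := P.isInt_of_mem_periodicSolutions hg hgM hp
  refine ⟨_, u, u', _, h, h0 ▸ hCR _, fun s₁ v v' k₁ hv hv0 => ?_⟩
  obtain ⟨hmem, hs⟩ := hv.mem_periodicSolutions hg (C := C)
    (U := ⟨fun t : Icc 0 P.T => v t, hv.cont.comp continuous_subtype_val⟩) (fun t => rfl) (by
      have := abs_le.1 hv0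
      simp only [hCdef, ContinuousMap.coe_mk]
      rw [min_eq_left this.2, max_eq_right this.1])
  rw [← hs]
  exact hmin hmem

theorem exists_superlinear_bound (P : WEProblem) {κ : ℝ} (hκ : 0 ≤ κ) :
    ∃ C, 0 ≤ C ∧ ∀ x, κ * |x| - C ≤ P.φ x * x := by
  set X := P.ψ κ with hX
  set Y := P.ψ (-κ) with hY
  have hX0 : 0 ≤ X := by
    rw [← P.ψ_zero]
    exact P.ψ_mono.monotone hκ
  have hY0 : Y ≤ 0 := by
    rw [← P.ψ_zero]
    exact P.ψ_mono.monotone (by linarith)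
  have hφX : P.φ X = κ := P.φ_ψ κ
  have hφY : P.φ Y = -κ := P.φ_ψ (-κ)
  refine ⟨κ * X + κ * (-Y), by nlinarith, fun x => ?_⟩
  rcases le_total 0 x with hx | hx
  · rw [abs_of_nonneg hx]
    rcases le_total X x with h | h
    · have := P.φ_mono.monotone h
      nlinarith
    · have := P.φ_mono.monotone hx
      rw [P.φ_zero] at this
      nlinarith [mul_le_mul_of_nonneg_left h hκ]
  · rw [abs_of_nonpos hx]
    rcases le_total x Y with h | h
    · have := P.φ_mono.monotone h
      nlinarith
    · have := P.φ_mono.monotone hx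
      rw [P.φ_zero] at this
      nlinarith [mul_le_mul_of_nonneg_left h hκ]

/-- A bound for the oscillation of periodic solutions, uniform in the truncation and in bounded
above parameters. -/
theorem exists_oscillation_bound (P : WEProblem) {Q : ℝ} (hQ : ∀ x, -Q ≤ P.q x) (σ : ℝ) :
    ∃ B, 0 ≤ B ∧ ∀ g, Continuous g → ∀ s u u' k, P.IsInt g s u u' k → s ≤ σ →
      ∀ t ∈ Icc 0 P.T, ∀ t' ∈ Icc 0 P.T, u t - u t' ≤ B := by
  have hA := P.A_nonneg
  set c := |σ| + P.A + P.A * |Q| with hc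
  have hc0 : 0 ≤ c := by positivity
  have hcT : 0 ≤ c * P.T := mul_nonneg hc0 P.T_pos.le
  obtain ⟨C, hC0, hC⟩ := P.exists_superlinear_bound (κ := c * P.T + 1) (by linarith)
  refine ⟨C * P.T, mul_nonneg hC0 P.T_pos.le, fun g hg s u u' k h hs => ?_⟩
  have hrhs : ∀ τ, P.rhs g s u τ ≤ c := by
    intro τ
    unfold rhs
    have h1 := (abs_le.1 (P.e_le τ)).2
    have h2 : -|Q| ≤ P.q (g (u τ)) := (neg_le_neg (le_abs_self Q)).trans (hQ _)
    have h3 := P.a_nonneg τ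
    have h4 : P.a τ * |Q| ≤ P.A * |Q| := mul_le_mul_of_nonneg_right (P.a_le τ) (abs_nonneg Q)
    have h5 := mul_le_mul_of_nonneg_left h2 h3
    have := le_abs_self σ
    linarith
  have hintegral := P.rhs_int hg h.cont s
  set W : ℝ → ℝ := fun t => ∫ τ in (0:ℝ)..t, P.rhs g s u τ with hW
  have hWcont : Continuous W := intervalIntegral.continuous_primitive hintegral 0
  have hint_le : ∀ x y, 0 ≤ x → x ≤ y → y ≤ P.T → ∫ τ in x..y, P.rhs g s u τ ≤ c * P.T := by
    intro x y hx hxy hy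
    have := intervalIntegral.integral_mono_on hxy (hintegral x y) intervalIntegrable_const
      fun τ _ => hrhs τ
    rw [intervalIntegral.integral_const, smul_eq_mul] at this
    nlinarith
  have hWabs : ∀ t ∈ Icc 0 P.T, |W t| ≤ c * P.T := by
    intro t ht
    have h1 := hint_le 0 t le_rfl ht.1 ht.2
    have h2 := hint_le t P.T ht.1 ht.2 le_rfl
    have h3 := intervalIntegral.integral_add_adjacent_intervals (hintegral 0 t) (hintegral t P.T)
    rw [h.mean] at h3
    rw [abs_le]
    constructor <;> simp only [hW] <;> linarith
  have hFg : Continuous fun x => P.F (g x) := P.F_cont.comp hg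
  have henergy : ∫ t in (0:ℝ)..P.T, (P.φ (u' t) * u' t - W t * u' t) = 0 := by
    have h1 : ∫ t in (0:ℝ)..P.T, (P.φ (u' t) * u' t - W t * u' t) =
        ∫ t in (0:ℝ)..P.T, (fun x => k - P.F (g x)) (u t) * u' t := by
      apply intervalIntegral.integral_congr
      intro t ht
      rw [uIcc_of_le P.T_pos.le] at ht
      simp only [h.eq t ht, hW]
      ring
    have h2 := intervalIntegral.integral_comp_mul_deriv (a := 0) (b := P.T) (f := u) (f' := u')
      (g := fun x => k - P.F (g x)) (fun x _ => h.hasDerivAt x) h.cont'.continuousOn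
      (continuous_const.sub hFg)
    rw [← h.per, intervalIntegral.integral_same] at h2
    rw [h1]
    exact h2
  have hcont1 : Continuous fun t => P.φ (u' t) * u' t - W t * u' t :=
    ((P.φ_cont.comp h.cont').mul h.cont').sub (hWcont.mul h.cont')
  have habs : ∫ t in (0:ℝ)..P.T, |u' t| ≤ C * P.T := by
    have := intervalIntegral.integral_mono_on (μ := volume) P.T_pos.le
      (h.cont'.abs.intervalIntegrable 0 P.T)
      ((hcont1.add continuous_const).intervalIntegrable 0 P.T)
      (g := fun t => P.φ (u' t) * u' t - W t * u' t + C) fun t ht => by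
        have h1 := hC (u' t)
        have h2 : W t * u' t ≤ c * P.T * |u' t| :=
          (le_abs_self _).trans ((abs_mul _ _).le.trans
            (mul_le_mul_of_nonneg_right (hWabs t ht) (abs_nonneg _)))
        linarith
    rw [intervalIntegral.integral_add (hcont1.intervalIntegrable _ _) intervalIntegrable_const,
      henergy, intervalIntegral.integral_const, smul_eq_mul] at this
    linarith
  intro t ht t' ht'
  rw [← intervalIntegral.integral_eq_sub_of_hasDerivAt (fun x _ => h.hasDerivAt x)
      (h.cont'.intervalIntegrable _ _)]
  refine (le_abs_self _).trans (le_trans ?_ habs)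
  have h1 := intervalIntegral.norm_integral_le_integral_norm_uIoc (f := u') (a := t') (b := t)
    (μ := volume)
  refine h1.trans ?_
  rw [intervalIntegral.integral_of_le P.T_pos.le]
  apply setIntegral_mono_set
  · exact (intervalIntegrable_iff_integrableOn_Ioc_of_le P.T_pos.le).1
      (h.cont'.abs.intervalIntegrable 0 P.T)
  · exact Eventually.of_forall fun x => abs_nonneg _
  · apply LE.le.eventuallyLE
    intro x hx
    exact ⟨(le_min ht'.1 ht.1).trans_lt hx.1, hx.2.trans (max_le ht'.2 ht.2)⟩

theorem IsInt.mul_le {P : WEProblem} {g : ℝ → ℝ} {s : ℝ} {u u' : ℝ → ℝ} {k : ℝ}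
    (h : P.IsInt g s u u' k) (hg : Continuous g) {m : ℝ}
    (hm : ∀ t ∈ Icc 0 P.T, m ≤ P.q (g (u t))) :
    P.aI * m ≤ P.T * s := by
  rw [h.mul_T hg, aI, ← intervalIntegral.integral_mul_const]
  have hq : Continuous fun τ => P.q (g (u τ)) := P.q_cont.comp (hg.comp h.cont)
  exact intervalIntegral.integral_mono_on P.T_pos.le ((P.a_int _ _).mul_const m)
    (P.a_mul_int hq _ _) fun t ht => mul_le_mul_of_nonneg_left (hm t ht) (P.a_nonneg t)

theorem IsInt.lt_mul {P : WEProblem} {g : ℝ → ℝ} {s : ℝ} {u u' : ℝ → ℝ} {k : ℝ}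
    (h : P.IsInt g s u u' k) (hg : Continuous g) {m : ℝ}
    (hm : ∀ t ∈ Icc 0 P.T, P.q (g (u t)) < m) :
    P.T * s < P.aI * m := by
  have hq : Continuous fun τ => P.q (g (u τ)) := P.q_cont.comp (hg.comp h.cont)
  obtain ⟨t₀, ht₀, hmax⟩ := (isCompact_Icc (a := 0) (b := P.T)).exists_isMaxOn
    ⟨0, le_rfl, P.T_pos.le⟩ hq.continuousOn
  refine lt_of_le_of_lt ?_ (mul_lt_mul_of_pos_left (hm t₀ ht₀) P.aI_pos)
  rw [h.mul_T hg, aI, ← intervalIntegral.integral_mul_const]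
  exact intervalIntegral.integral_mono_on P.T_pos.le (P.a_mul_int hq _ _)
    ((P.a_int _ _).mul_const _) fun t ht => mul_le_mul_of_nonneg_left (hmax ht) (P.a_nonneg t)

end WEProblem

theorem HasDerivAt.nonneg_of_nonneg_right {d : ℝ → ℝ} {d' x b : ℝ} (h : HasDerivAt d d' x)
    (hx : d x = 0) (hxb : x < b) (hd : ∀ y ∈ Ioo x b, 0 ≤ d y) : 0 ≤ d' := by
  have h1 := (hasDerivWithinAt_iff_tendsto_slope' (s := Ioi x) (by simp)).1
    (h.hasDerivWithinAt (s := Ioi x))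
  refine ge_of_tendsto h1 ?_
  filter_upwards [Ioo_mem_nhdsGT hxb] with y hy
  rw [slope_def_field, hx, sub_zero]
  exact div_nonneg (hd y hy) (sub_nonneg.2 hy.1.le)

theorem HasDerivAt.nonpos_of_nonneg_left {d : ℝ → ℝ} {d' x b : ℝ} (h : HasDerivAt d d' x)
    (hx : d x = 0) (hxb : b < x) (hd : ∀ y ∈ Ioo b x, 0 ≤ d y) : d' ≤ 0 := by
  have h1 := (hasDerivWithinAt_iff_tendsto_slope' (s := Iio x) (by simp)).1
    (h.hasDerivWithinAt (s := Iio x))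
  refine le_of_tendsto h1 ?_
  filter_upwards [Ioo_mem_nhdsLT hxb] with y hy
  rw [slope_def_field, hx, sub_zero]
  exact div_nonpos_of_nonneg_of_nonpos (hd y hy) (sub_nonpos.2 hy.2.le)

namespace WEProblem

/-- A solution lying below a solution with a smaller parameter lies strictly below it. -/
theorem IsInt.lt_of_le {P : WEProblem} {g : ℝ → ℝ} (hg : Continuous g) {s₀ s : ℝ}
    {β β' u u' : ℝ → ℝ} {k₀ k : ℝ} (hβ : P.IsInt g s₀ β β' k₀) (hu : P.IsInt g s u u' k)
    (hs : s₀ < s) (hgβ : ∀ t ∈ Icc 0 P.T, ∀ᶠ x in 𝓝 (β t), g x = x)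
    (hle : ∀ t ∈ Icc 0 P.T, u t ≤ β t) : ∀ t ∈ Icc 0 P.T, u t < β t := by
  intro t ht
  by_contra hlt
  obtain ⟨t₁, ht₁, htouch⟩ : ∃ t₁ ∈ Ico 0 P.T, u t₁ = β t₁ := by
    have heq : u t = β t := le_antisymm (hle t ht) (not_lt.1 hlt)
    rcases ht.2.lt_or_eq with h | h
    · exact ⟨t, ⟨ht.1, h⟩, heq⟩
    · exact ⟨0, ⟨le_rfl, P.T_pos⟩, by rw [hu.per, hβ.per, ← h, heq]⟩
  have hd : ∀ t, HasDerivAt (fun t => β t - u t) (β' t - u' t) t := fun t =>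
    (hβ.hasDerivAt t).sub (hu.hasDerivAt t)
  have hright : 0 ≤ β' t₁ - u' t₁ := (hd t₁).nonneg_of_nonneg_right (by simp [htouch]) ht₁.2
    fun y hy => sub_nonneg.2 (hle y ⟨ht₁.1.trans hy.1.le, hy.2.le⟩)
  have hleft : β' t₁ - u' t₁ ≤ 0 := by
    rcases ht₁.1.lt_or_eq with h | h
    · exact (hd t₁).nonpos_of_nonneg_left (by simp [htouch]) h
        fun y hy => sub_nonneg.2 (hle y ⟨hy.1.le, hy.2.le.trans ht₁.2.le⟩)
    · rw [← h] at htouch ⊢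
      rw [hβ.per', hu.per']
      exact (hd P.T).nonpos_of_nonneg_left (by simp [← hu.per, ← hβ.per, htouch]) P.T_pos
        fun y hy => sub_nonneg.2 (hle y ⟨hy.1.le, hy.2.le⟩)
  have hderiv : u' t₁ = β' t₁ := by linarith
  have ht₁' : t₁ ∈ Icc 0 P.T := Ico_subset_Icc_self ht₁
  set ε := (s - s₀) / 4 with hε
  have hε0 : 0 < ε := by rw [hε]; linarith
  have hcomp : ∀ v v' : ℝ → ℝ, (∀ t, HasDerivAt v (v' t) t) → v t₁ = β t₁ →
      HasDerivAt (fun t => P.F (g (v t))) (P.f (β t₁) * v' t₁) t₁ := by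
    intro v v' hv hvt
    have h1 : (fun t => P.F (g (v t))) =ᶠ[𝓝 t₁] fun t => P.F (v t) := by
      have h2 : Tendsto v (𝓝 t₁) (𝓝 (β t₁)) := hvt ▸ (hv t₁).continuousAt
      filter_upwards [h2.eventually (hgβ t₁ ht₁')] with y hy
      rw [hy]
    refine HasDerivAt.congr_of_eventuallyEq ?_ h1
    rw [← hvt]
    exact (P.F_hasDerivAt (v t₁)).comp t₁ (hv t₁)
  have hH : HasDerivAt (fun t => P.F (g (β t)) - P.F (g (u t))) 0 t₁ := by
    have := (hcomp β β' hβ.hasDerivAt rfl).sub (hcomp u u' hu.hasDerivAt htouch)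
    rwa [hderiv, sub_self] at this
  have hHsmall : ∀ᶠ t in 𝓝 t₁, |P.F (g (β t)) - P.F (g (u t))| ≤ ε * |t - t₁| := by
    have := (hasDerivAt_iff_isLittleO.1 hH).def hε0
    filter_upwards [this] with y hy
    simpa [htouch] using hy
  have hqcont : Continuous fun τ => P.q (g (u τ)) - P.q (g (β τ)) :=
    (P.q_cont.comp (hg.comp hu.cont)).sub (P.q_cont.comp (hg.comp hβ.cont))
  have hqsmall : ∀ᶠ t in 𝓝 t₁, P.A * |P.q (g (u t)) - P.q (g (β t))| < ε := by
    have h1 : Continuous fun τ => P.A * |P.q (g (u τ)) - P.q (g (β τ))| :=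
      continuous_const.mul hqcont.abs
    exact h1.continuousAt.eventually_lt continuousAt_const (by simpa [htouch] using hε0)
  obtain ⟨δ, hδ0, hδ⟩ := Metric.eventually_nhds_iff.1 (hHsmall.and hqsmall)
  set b := min (t₁ + δ / 2) P.T with hb
  have hbt : t₁ < b := lt_min (by linarith) ht₁.2
  have hnear : ∀ t ∈ Icc t₁ b, dist t t₁ < δ := by
    intro t ht
    rw [Real.dist_eq, abs_of_nonneg (sub_nonneg.2 ht.1)]
    have := ht.2.trans (min_le_left _ _)
    linarith
  have hneg : ∀ t ∈ Ioo t₁ b, β' t - u' t < 0 := by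
    intro t ht
    have htI : t ∈ Icc 0 P.T := ⟨ht₁.1.trans ht.1.le, ht.2.le.trans (min_le_right _ _)⟩
    have hpos : 0 < t - t₁ := sub_pos.2 ht.1
    rw [sub_neg]
    apply P.φ_mono.lt_iff_lt.1
    have e1 := hu.eq t htI
    have e2 := hβ.eq t htI
    have e3 := hu.eq t₁ ht₁'
    have e4 := hβ.eq t₁ ht₁'
    rw [hderiv, htouch] at e3
    have i1 := intervalIntegral.integral_add_adjacent_intervals (P.rhs_int hg hu.cont s 0 t₁)
      (P.rhs_int hg hu.cont s t₁ t)
    have i2 := intervalIntegral.integral_add_adjacent_intervals (P.rhs_int hg hβ.cont s₀ 0 t₁)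
      (P.rhs_int hg hβ.cont s₀ t₁ t)
    have i3 : (t - t₁) * (3 * ε) ≤
        ∫ τ in t₁..t, (P.rhs g s u τ - P.rhs g s₀ β τ) := by
      have := intervalIntegral.integral_mono_on (μ := volume) ht.1.le
        (intervalIntegrable_const (c := 3 * ε))
        ((P.rhs_int hg hu.cont s t₁ t).sub (P.rhs_int hg hβ.cont s₀ t₁ t)) fun τ hτ => by
          have h1 := (hδ (hnear τ ⟨hτ.1, hτ.2.trans ht.2.le⟩)).2
          have h2 : P.a τ * (P.q (g (u τ)) - P.q (g (β τ))) ≤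
              P.A * |P.q (g (u τ)) - P.q (g (β τ))| :=
            (mul_le_mul_of_nonneg_left (le_abs_self _) (P.a_nonneg τ)).trans
              (mul_le_mul_of_nonneg_right (P.a_le τ) (abs_nonneg _))
          simp only [rhs]
          linarith
      rwa [intervalIntegral.integral_const, smul_eq_mul] at this
    rw [intervalIntegral.integral_sub (P.rhs_int hg hu.cont s t₁ t)
      (P.rhs_int hg hβ.cont s₀ t₁ t)] at i3
    have h1 := (abs_le.1 (hδ (hnear t ⟨ht.1.le, ht.2.le⟩)).1).1
    rw [abs_of_pos hpos] at h1
    nlinarith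
  have hanti : StrictAntiOn (fun t => β t - u t) (Icc t₁ b) := by
    apply strictAntiOn_of_deriv_neg (convex_Icc _ _)
    · exact (hβ.cont.sub hu.cont).continuousOn
    · intro x hx
      rw [interior_Icc] at hx
      rw [(hd x).deriv]
      exact hneg x hx
  have := hanti (left_mem_Icc.2 hbt.le) (right_mem_Icc.2 hbt.le) hbt
  simp only [htouch, sub_self] at this
  have := hle b ⟨ht₁.1.trans hbt.le, min_le_right _ _⟩
  linarith

end WEProblem

/-- The retraction of the line onto `[l, r]`. -/
def clip (l r x : ℝ) : ℝ := max l (min x r)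

theorem continuous_clip (l r : ℝ) : Continuous (clip l r) := by
  unfold clip
  fun_prop

theorem clip_mem {l r : ℝ} (h : l ≤ r) (x : ℝ) : clip l r x ∈ Icc l r :=
  ⟨le_max_left _ _, max_le h (min_le_right _ _)⟩

theorem clip_of_mem {l r x : ℝ} (h : x ∈ Icc l r) : clip l r x = x := by
  rw [clip, min_eq_left h.2, max_eq_right h.1]

theorem clip_of_ge {l r x : ℝ} (h : l ≤ r) (hx : r ≤ x) : clip l r x = r := by
  rw [clip, min_eq_right hx, max_eq_right h]

theorem clip_of_le {l r x : ℝ} (hx : x ≤ l) : clip l r x = l := by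
  rw [clip, max_eq_left ((min_le_left _ _).trans hx)]

theorem le_clip {l r c x : ℝ} (hc : c ≤ r) (hx : c ≤ x) : c ≤ clip l r x :=
  le_max_of_le_right (le_min hx hc)

theorem clip_le {l r c x : ℝ} (hc : l ≤ c) (hx : x ≤ c) : clip l r x ≤ c :=
  max_le hc ((min_le_left _ _).trans hx)

theorem abs_clip_le {l r : ℝ} (h : l ≤ r) (x : ℝ) : |clip l r x| ≤ max |l| |r| :=
  abs_le_max_abs_abs (clip_mem h x).1 (clip_mem h x).2

theorem eq_clip_add_cases {R x c : ℝ} (hR : 0 ≤ R) (h : x = clip (-R) R (x + c)) :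
    c = 0 ∨ (0 < c ∧ x = R) ∨ (c < 0 ∧ x = -R) := by
  rcases lt_trichotomy c 0 with hc | hc | hc
  · right; right
    refine ⟨hc, ?_⟩
    by_contra hne
    rcases le_total (x + c) (-R) with h1 | h1
    · exact hne (h.trans (clip_of_le h1))
    · have h2 : clip (-R) R (x + c) ≤ x + c := clip_le h1 le_rfl
      linarith
  · exact Or.inl hc
  · right; left
    refine ⟨hc, ?_⟩
    by_contra hne
    rcases le_total R (x + c) with h1 | h1
    · exact hne (h.trans (clip_of_ge (by linarith) h1))
    · have h2 : x + c ≤ clip (-R) R (x + c) := le_clip h1 le_rfl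
      linarith

namespace WEProblem

theorem IsInt.le_of_osc {P : WEProblem} {g : ℝ → ℝ} {s : ℝ} {u u' : ℝ → ℝ} {k : ℝ}
    (h : P.IsInt g s u u' k) (hg : Continuous g) {B R m : ℝ}
    (hB : ∀ t ∈ Icc 0 P.T, ∀ t' ∈ Icc 0 P.T, u t - u t' ≤ B) (hgR : ∀ x, R ≤ x → R ≤ g x)
    (hq : ∀ x, R ≤ x → m ≤ P.q x) (hs : P.T * s < P.aI * m) :
    ∀ t ∈ Icc 0 P.T, u t ≤ R + B := by
  intro t ht
  by_contra hlt
  refine hs.not_ge (h.mul_le hg fun t' ht' => hq _ (hgR _ ?_))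
  linarith [hB t ht t' ht']

theorem IsInt.ge_of_osc {P : WEProblem} {g : ℝ → ℝ} {s : ℝ} {u u' : ℝ → ℝ} {k : ℝ}
    (h : P.IsInt g s u u' k) (hg : Continuous g) {B R m : ℝ}
    (hB : ∀ t ∈ Icc 0 P.T, ∀ t' ∈ Icc 0 P.T, u t - u t' ≤ B) (hgR : ∀ x, x ≤ -R → g x ≤ -R)
    (hq : ∀ x, x ≤ -R → m ≤ P.q x) (hs : P.T * s < P.aI * m) :
    ∀ t ∈ Icc 0 P.T, -(R + B) ≤ u t := by
  intro t ht
  by_contra hlt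
  refine hs.not_ge (h.mul_le hg fun t' ht' => hq _ (hgR _ ?_))
  linarith [hB t' ht' t ht]

/-- If `q < w` on arbitrarily long intervals, then there is a solution whose parameter is smaller
than `w` times the mean value of `a`. -/
theorem exists_isInt_lt (P : WEProblem) {Q : ℝ} (hQ : ∀ x, -Q ≤ P.q x) {w : ℝ}
    (hw : ∀ B, 0 ≤ B → ∃ c, ∀ x ∈ Icc (c - B) (c + B), P.q x < w) :
    ∃ s u u' k, P.IsInt id s u u' k ∧ P.T * s < P.aI * w := by
  obtain ⟨B, hB0, hB⟩ := P.exists_oscillation_bound hQ (P.aI * w / P.T)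
  obtain ⟨c, hc⟩ := hw B hB0
  have hle : c - B ≤ c + B := by linarith
  have hg := continuous_clip (c - B) (c + B)
  obtain ⟨s, u, u', k, U, h, -, h0⟩ := P.exists_isInt hg (abs_clip_le hle)
    (C := fun _ _ => c) continuous_const (fun _ _ => le_rfl)
  have hs : P.T * s < P.aI * w := h.lt_mul hg fun t _ => hc _ (clip_mem hle _)
  have hs' : s ≤ P.aI * w / P.T := by
    rw [le_div_iff₀ P.T_pos]
    linarith
  have h0mem : (0:ℝ) ∈ Icc 0 P.T := ⟨le_rfl, P.T_pos.le⟩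
  refine ⟨s, u, u', k, h.congr fun t ht => clip_of_mem ?_, hs⟩
  have h1 := hB _ hg _ _ _ _ h hs' t ht 0 h0mem
  have h2 := hB _ hg _ _ _ _ h hs' 0 h0mem t ht
  rw [h0] at h1 h2
  constructor <;> linarith

/-- Existence of a solution with the smallest parameter. -/
theorem exists_minimal_solution (P : WEProblem) {Q : ℝ} (hQ : ∀ x, -Q ≤ P.q x) {m R σ : ℝ}
    (hR : 0 ≤ R) (hσ : P.T * σ < P.aI * m) (hql : ∀ x, x ≤ -R → m ≤ P.q x)
    (hqr : ∀ x, R ≤ x → m ≤ P.q x) (hex : ∃ u u' k, P.IsInt id σ u u' k) :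
    ∃ s₀ β β' k₀, P.IsInt id s₀ β β' k₀ ∧ s₀ ≤ σ ∧
      ∀ s u u' k, P.IsInt id s u u' k → s₀ ≤ s := by
  obtain ⟨B, hB0, hB⟩ := P.exists_oscillation_bound hQ σ
  set M := R + B with hM
  have hMM : -M ≤ M := by linarith
  have hg := continuous_clip (-M) M
  have h0mem : (0:ℝ) ∈ Icc 0 P.T := ⟨le_rfl, P.T_pos.le⟩
  have hbound : ∀ g, Continuous g → (∀ x, R ≤ x → R ≤ g x) → (∀ x, x ≤ -R → g x ≤ -R) →
      ∀ s u u' k, P.IsInt g s u u' k → s ≤ σ → ∀ t ∈ Icc 0 P.T, u t ∈ Icc (-M) M := by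
    intro g hg h1 h2 s u u' k h hs t ht
    have hs' : P.T * s < P.aI * m :=
      (mul_le_mul_of_nonneg_left hs P.T_pos.le).trans_lt hσ
    exact ⟨h.ge_of_osc hg (hB _ hg _ _ _ _ h hs) h2 hql hs' t ht,
      h.le_of_osc hg (hB _ hg _ _ _ _ h hs) h1 hqr hs' t ht⟩
  obtain ⟨s₀, β, β', k₀, hβ, -, hmin⟩ := P.exists_isInt_minimal hg (abs_clip_le hMM)
    (R := M) (by linarith)
  have hle : ∀ s u u' k, P.IsInt id s u u' k → s ≤ σ → s₀ ≤ s := by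
    intro s u u' k h hs
    have hu := hbound id continuous_id (fun _ => id) (fun _ => id) s u u' k h hs
    exact hmin s u u' k (h.congr fun t ht => (clip_of_mem (hu t ht)).symm)
      (abs_le.2 (hu 0 h0mem))
  obtain ⟨u, u', k, hu⟩ := hex
  have hs₀ : s₀ ≤ σ := hle σ u u' k hu le_rfl
  refine ⟨s₀, β, β', k₀, hβ.congr fun t ht => ?_, hs₀, fun s v v' k hv => ?_⟩
  · exact clip_of_mem (hbound _ hg (fun x hx => le_clip (by linarith) hx)
      (fun x hx => clip_le (by linarith) hx) _ _ _ _ hβ hs₀ t ht)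
  · rcases le_total s σ with h | h
    · exact hle s v v' k hv h
    · exact hs₀.trans h

/-- A signed measure of how far a function lies below `β`. -/
theorem exists_below_functional {X : Type*} [TopologicalSpace X] [CompactSpace X] (β : C(X, ℝ)) :
    ∃ d : C(X, ℝ) → ℝ, Continuous d ∧ (∀ U, 0 < d U ↔ ∀ x, U x < β x) ∧
      ∀ U, 0 ≤ d U ↔ ∀ x, U x ≤ β x := by
  set h : C(ℝ, ℝ) := ⟨fun y => max (y + 1) 0, by fun_prop⟩ with hh
  refine ⟨fun U => 1 - ‖h.comp (U - β)‖, continuous_const.sub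
    ((ContinuousMap.continuous_postcomp h).comp (continuous_id.sub continuous_const)).norm,
    fun U => ?_, fun U => ?_⟩
  · rw [sub_pos, ContinuousMap.norm_lt_iff _ one_pos]
    refine forall_congr' fun x => ?_
    have : ‖h.comp (U - β) x‖ = max (U x - β x + 1) 0 :=
      abs_of_nonneg (le_max_right _ _)
    rw [this, max_lt_iff]
    constructor
    · intro h
      linarith [h.1]
    · intro h
      exact ⟨by linarith, one_pos⟩
  · rw [sub_nonneg, ContinuousMap.norm_le _ zero_le_one]
    refine forall_congr' fun x => ?_
    have : ‖h.comp (U - β) x‖ = max (U x - β x + 1) 0 :=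
      abs_of_nonneg (le_max_right _ _)
    rw [this, max_le_iff]
    constructor
    · intro h
      linarith [h.1]
    · intro h
      exact ⟨by linarith, zero_le_one⟩

/-- Solutions of the truncated equation selected by a scalar equation `θ s d = 0`, where `d`
measures the position with respect to `β`, up to solutions staying beyond the truncation. -/
theorem exists_isInt_selected (P : WEProblem) {Q : ℝ} (hQ : ∀ x, -Q ≤ P.q x) {M : ℝ} (hM : 0 ≤ M)
    {β : ℝ → ℝ} (hβ : Continuous β) {θ : ℝ → ℝ → ℝ} (hθ : Continuous (Function.uncurry θ)) :
    ∃ s u u' k d, P.IsInt (clip (-M) M) s u u' k ∧ (0 < d ↔ ∀ t ∈ Icc 0 P.T, u t < β t) ∧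
      (0 ≤ d ↔ ∀ t ∈ Icc 0 P.T, u t ≤ β t) ∧
      (θ s d = 0 ∨ (0 < θ s d ∧ ∀ t ∈ Icc 0 P.T, M ≤ u t) ∨
        (θ s d < 0 ∧ ∀ t ∈ Icc 0 P.T, u t ≤ -M)) := by
  have hMM : -M ≤ M := by linarith
  have hg := continuous_clip (-M) M
  have h0mem : (0:ℝ) ∈ Icc 0 P.T := ⟨le_rfl, P.T_pos.le⟩
  obtain ⟨q₁, -, hq₁⟩ := exists_bound_comp P.q_cont (abs_clip_le hMM)
  obtain ⟨B, hB0, hB⟩ := P.exists_oscillation_bound hQ (P.aI * (q₁ + 1) / P.T)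
  obtain ⟨d, hd, hd1, hd2⟩ := exists_below_functional
    (⟨fun t : Icc 0 P.T => β t, hβ.comp continuous_subtype_val⟩ : C(Icc 0 P.T, ℝ))
  set R := M + B with hR
  have hRR : -R ≤ R := by linarith
  obtain ⟨s, u, u', k, U, h, hU, h0⟩ := P.exists_isInt hg (abs_clip_le hMM)
    (C := fun U s => clip (-R) R (U ⟨0, h0mem⟩ + θ s (d U))) (by
      refine (continuous_clip _ _).comp (Continuous.add (by fun_prop) ?_)
      exact hθ.comp (continuous_snd.prodMk (hd.comp continuous_fst)))
    (fun U s => abs_clip_le hRR _)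
  have hs : s ≤ P.aI * (q₁ + 1) / P.T := by
    rw [le_div_iff₀ P.T_pos, mul_comm]
    refine (h.lt_mul hg fun t _ => ?_).le
    linarith [(abs_le.1 (hq₁ (u t))).2]
  have hosc := hB _ hg _ _ _ _ h hs
  refine ⟨s, u, u', k, d U, h, ?_, ?_, ?_⟩
  · rw [hd1]
    simp [hU]
  · rw [hd2]
    simp [hU]
  · rw [hU] at h0
    rcases eq_clip_add_cases (by linarith) h0 with h1 | ⟨h1, h2⟩ | ⟨h1, h2⟩
    · exact Or.inl h1
    · refine Or.inr (Or.inl ⟨h1, fun t ht => ?_⟩)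
      linarith [hosc 0 h0mem t ht]
    · refine Or.inr (Or.inr ⟨h1, fun t ht => ?_⟩)
      linarith [hosc t ht 0 h0mem]

/-- Truncation levels `M` adapted to a solution `β`. -/
theorem IsInt.exists_truncation {P : WEProblem} {s₀ : ℝ} {β β' : ℝ → ℝ} {k₀ : ℝ}
    (hβ : P.IsInt id s₀ β β' k₀) (N : ℝ) :
    ∃ M, 0 ≤ M ∧ N ≤ M ∧ (∀ t ∈ Icc 0 P.T, β t ∈ Ioo (-M) M) ∧
      P.IsInt (clip (-M) M) s₀ β β' k₀ ∧
      ∀ t ∈ Icc 0 P.T, ∀ᶠ x in 𝓝 (β t), clip (-M) M x = x := by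
  obtain ⟨b, hb⟩ := (isCompact_Icc (a := 0) (b := P.T)).exists_bound_of_continuousOn
    hβ.cont.continuousOn
  have hb0 : 0 ≤ b := (norm_nonneg _).trans (hb 0 ⟨le_rfl, P.T_pos.le⟩)
  have hmem : ∀ t ∈ Icc 0 P.T, β t ∈ Ioo (-max N (b + 1)) (max N (b + 1)) := by
    intro t ht
    have h1 := abs_le.1 (hb t ht)
    have h2 := le_max_right N (b + 1)
    constructor <;> linarith
  refine ⟨max N (b + 1), le_max_of_le_right (by linarith), le_max_left _ _, hmem, ?_, ?_⟩
  · exact hβ.congr fun t ht => (clip_of_mem (Ioo_subset_Icc_self (hmem t ht))).symm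
  · intro t ht
    filter_upwards [Ioo_mem_nhds (hmem t ht).1 (hmem t ht).2] with x hx
    exact clip_of_mem (Ioo_subset_Icc_self hx)

theorem IsInt.exists_solution_below {P : WEProblem} {Q : ℝ} (hQ : ∀ x, -Q ≤ P.q x) {s₀ : ℝ}
    {β β' : ℝ → ℝ} {k₀ : ℝ} (hβ : P.IsInt id s₀ β β' k₀) {s m R : ℝ} (hs₀ : s₀ < s)
    (hs : P.T * s < P.aI * m) (hql : ∀ x, x ≤ -R → m ≤ P.q x) :
    ∃ u u' k, P.IsInt id s u u' k ∧ ∀ t ∈ Icc 0 P.T, u t < β t := by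
  have h0mem : (0:ℝ) ∈ Icc 0 P.T := ⟨le_rfl, P.T_pos.le⟩
  obtain ⟨B, hB0, hB⟩ := P.exists_oscillation_bound hQ s
  obtain ⟨M, hM0, hM, hβM, hβ', hnhds⟩ := hβ.exists_truncation (R + B)
  have hg := continuous_clip (-M) M
  obtain ⟨s₁, u, u', k, d, h, hd1, hd2, hcases⟩ := P.exists_isInt_selected hQ hM0 hβ.cont
    (θ := fun x y => min (x - s) y) (by fun_prop)
  rcases hcases with hθ | ⟨hθ, hu⟩ | ⟨hθ, hu⟩
  · have hs₁ : s ≤ s₁ := by linarith [hθ.symm.le.trans (min_le_left (s₁ - s) d)]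
    have hle := hd2.1 (hθ.symm.le.trans (min_le_right (s₁ - s) d))
    have hlt := hβ'.lt_of_le hg h (hs₀.trans_le hs₁) hnhds hle
    have hd := hd1.2 hlt
    have heq : s₁ = s := by
      rcases min_choice (s₁ - s) d with h1 | h1 <;> rw [h1] at hθ <;> linarith
    subst heq
    refine ⟨u, u', k, h.congr fun t ht => clip_of_mem ⟨?_, ?_⟩, hlt⟩
    · have := h.ge_of_osc hg (hB _ hg _ _ _ _ h le_rfl)
        (fun x hx => clip_le (by linarith) hx) hql hs t ht
      linarith
    · exact (hlt t ht).le.trans (hβM t ht).2.le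
  · have h1 := hd1.1 (hθ.trans_le (min_le_right _ _)) 0 h0mem
    linarith [hu 0 h0mem, (hβM 0 h0mem).2]
  · have hd := hd1.2 fun t ht => (hu t ht).trans_lt (hβM t ht).1
    have h1 : P.aI * m ≤ P.T * s₁ := h.mul_le hg fun t ht => by
      rw [clip_of_le (hu t ht)]
      exact hql _ (by linarith)
    have h2 : s < s₁ := lt_of_mul_lt_mul_left (hs.trans_le h1) P.T_pos.le
    exact absurd hθ (not_lt.2 (le_min (by linarith) hd.le))

theorem IsInt.exists_solution_not_below {P : WEProblem} {Q : ℝ} (hQ : ∀ x, -Q ≤ P.q x) {s₀ : ℝ}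
    {β β' : ℝ → ℝ} {k₀ : ℝ} (hβ : P.IsInt id s₀ β β' k₀) {s m R : ℝ} (hs₀ : s₀ < s)
    (hs : P.T * s < P.aI * m) (hql : ∀ x, x ≤ -R → m ≤ P.q x) (hqr : ∀ x, R ≤ x → m ≤ P.q x) :
    ∃ u u' k, P.IsInt id s u u' k ∧ ∃ t ∈ Icc 0 P.T, β t < u t := by
  have h0mem : (0:ℝ) ∈ Icc 0 P.T := ⟨le_rfl, P.T_pos.le⟩
  obtain ⟨B, hB0, hB⟩ := P.exists_oscillation_bound hQ s
  obtain ⟨M, hM0, hM, hβM, hβ', hnhds⟩ := hβ.exists_truncation (R + B)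
  have hg := continuous_clip (-M) M
  obtain ⟨s₁, u, u', k, d, h, hd1, hd2, hcases⟩ := P.exists_isInt_selected hQ hM0 hβ.cont
    (θ := fun x y => max (s - x) y) (by fun_prop)
  rcases hcases with hθ | ⟨hθ, hu⟩ | ⟨hθ, hu⟩
  · have hs₁ : s ≤ s₁ := by linarith [(le_max_left (s - s₁) d).trans hθ.le]
    have hd : d < 0 := by
      refine lt_of_le_of_ne ((le_max_right (s - s₁) d).trans hθ.le) fun hd0 => ?_
      have := hd1.2 (hβ'.lt_of_le hg h (hs₀.trans_le hs₁) hnhds (hd2.1 hd0.ge))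
      linarith
    have heq : s₁ = s := by
      rcases max_choice (s - s₁) d with h1 | h1 <;> rw [h1] at hθ <;> linarith
    subst heq
    refine ⟨u, u', k, h.congr fun t ht => clip_of_mem ⟨?_, ?_⟩, ?_⟩
    · have := h.ge_of_osc hg (hB _ hg _ _ _ _ h le_rfl)
        (fun x hx => clip_le (by linarith) hx) hql hs t ht
      linarith
    · have := h.le_of_osc hg (hB _ hg _ _ _ _ h le_rfl)
        (fun x hx => le_clip (by linarith) hx) hqr hs t ht
      linarith
    · by_contra hcon
      push Not at hcon
      exact hd.not_ge (hd2.2 hcon)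
  · have hd : d < 0 := by
      by_contra hd
      have := hd2.1 (not_lt.1 hd) 0 h0mem
      linarith [hu 0 h0mem, (hβM 0 h0mem).2]
    have h1 : P.aI * m ≤ P.T * s₁ := h.mul_le hg fun t ht => by
      rw [clip_of_ge (by linarith) (hu t ht)]
      exact hqr _ (by linarith)
    have h2 : s < s₁ := lt_of_mul_lt_mul_left (hs.trans_le h1) P.T_pos.le
    exact absurd hθ (not_lt.2 (max_le (by linarith) hd.le))
  · have hd := hd1.2 fun t ht => (hu t ht).trans_lt (hβM t ht).1
    exact absurd hθ (not_lt.2 (hd.le.trans (le_max_right _ _)))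

/-- The coefficients `P` agree with the given ones almost everywhere on `[0, T]`. -/
structure Represents (P : WEProblem) (a e : ℝ → ℝ) : Prop where
  a_eq : ∀ᵐ t ∂(muT P.T), a t = P.a t
  e_eq : ∀ᵐ t ∂(muT P.T), e t = P.e t

theorem integral_f_comp (P : WEProblem) {u u' : ℝ → ℝ} (hu : ∀ t, HasDerivAt u (u' t) t)
    (hu' : Continuous u') (t : ℝ) :
    ∫ τ in (0:ℝ)..t, P.f (u τ) * u' τ = P.F (u t) - P.F (u 0) := by
  have hcont : Continuous u := continuous_iff_continuousAt.2 fun x => (hu x).continuousAt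
  exact intervalIntegral.integral_eq_sub_of_hasDerivAt (f := fun τ => P.F (u τ))
    (fun x _ => (P.F_hasDerivAt (u x)).comp x (hu x))
    (((P.f_cont.comp hcont).mul hu').intervalIntegrable _ _)

theorem IsInt.isSolWE {P : WEProblem} {a e : ℝ → ℝ} (hP : P.Represents a e) {s : ℝ}
    {u u' : ℝ → ℝ} {k : ℝ} (h : P.IsInt id s u u' k) : IsSolWE P.T P.φ P.f P.q a e s u := by
  have hfu : Continuous fun τ => P.f (u τ) * u' τ := (P.f_cont.comp h.cont).mul h.cont'
  have hrhs := P.rhs_int continuous_id h.cont s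
  refine ⟨u', fun τ => P.rhs id s u τ - P.f (u τ) * u' τ,
    ⟨fun t _ => (h.hasDerivAt t).hasDerivWithinAt, h.cont'.continuousOn, h.per, h.per'⟩,
    ⟨?_, fun t ht => ?_⟩, ?_⟩
  · exact (intervalIntegrable_iff_integrableOn_Icc_of_le P.T_pos.le).1
      ((hrhs 0 P.T).sub (hfu.intervalIntegrable _ _))
  · rw [intervalIntegral.integral_sub (hrhs 0 t) (hfu.intervalIntegrable _ _),
      P.integral_f_comp h.hasDerivAt h.cont', h.eq t ht, h.eq 0 ⟨le_rfl, P.T_pos.le⟩]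
    simp only [id, intervalIntegral.integral_same]
    ring
  · filter_upwards [hP.a_eq, hP.e_eq] with t h1 h2
    simp only [rhs, id, h1, h2]
    ring

theorem exists_isInt_of_isSolWE (P : WEProblem) {a e : ℝ → ℝ} (hP : P.Represents a e) {s : ℝ}
    {u : ℝ → ℝ} (h : IsSolWE P.T P.φ P.f P.q a e s u) : ∃ v v' k, P.IsInt id s v v' k := by
  obtain ⟨u', w, ⟨hu, hu', hper, hper'⟩, ⟨hwint, hw⟩, heq⟩ := h
  have hTmem : P.T ∈ Icc 0 P.T := ⟨P.T_pos.le, le_rfl⟩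
  set v' : ℝ → ℝ := IccExtend P.T_pos.le (domRestrict (Icc 0 P.T) u') with hv'
  have hv'cont : Continuous v' := (continuousOn_iff_continuous_domRestrict.1 hu').Icc_extend'
  have hv'eq : ∀ t ∈ Icc 0 P.T, v' t = u' t := fun t ht => IccExtend_of_mem _ _ ht
  set v : ℝ → ℝ := fun t => u 0 + ∫ τ in (0:ℝ)..t, v' τ with hv
  have hderiv : ∀ t, HasDerivAt v (v' t) t := fun t =>
    (hv'cont.integral_hasStrictDerivAt 0 t).hasDerivAt.const_add _
  have hvcont : Continuous v := continuous_iff_continuousAt.2 fun x => (hderiv x).continuousAt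
  have hveq : ∀ t ∈ Icc 0 P.T, v t = u t := by
    intro t ht
    have := intervalIntegral.integral_eq_sub_of_hasDerivAt_of_le (f := u) (f' := v') ht.1
      (fun x hx => (hu x ⟨hx.1, hx.2.trans ht.2⟩).continuousWithinAt.mono
        (Icc_subset_Icc_right ht.2))
      (fun x hx => by
        have hx' : x ∈ Ioo 0 P.T := ⟨hx.1, hx.2.trans_le ht.2⟩
        rw [hv'eq x (Ioo_subset_Icc_self hx')]
        exact (hu x (Ioo_subset_Icc_self hx')).hasDerivAt (Icc_mem_nhds hx'.1 hx'.2))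
      (hv'cont.intervalIntegrable _ _)
    simp only [hv, this]
    ring
  have hv0 : v 0 = u 0 := by simp [hv]
  have hfv : Continuous fun τ => P.f (v τ) * v' τ := (P.f_cont.comp hvcont).mul hv'cont
  have hwt : ∀ t ∈ Icc 0 P.T, ∫ τ in (0:ℝ)..t, w τ =
      (∫ τ in (0:ℝ)..t, P.rhs id s v τ) - (P.F (v t) - P.F (v 0)) := by
    intro t ht
    rw [← P.integral_f_comp hderiv hv'cont, ← intervalIntegral.integral_sub
      (P.rhs_int continuous_id hvcont s 0 t) (hfv.intervalIntegrable _ _)]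
    apply intervalIntegral.integral_congr_ae
    have hae : ∀ᵐ τ, τ ∈ Icc 0 P.T → w τ = P.rhs id s v τ - P.f (v τ) * v' τ := by
      rw [← ae_restrict_iff' measurableSet_Icc]
      have hmem : ∀ᵐ τ ∂(muT P.T), τ ∈ Icc 0 P.T := ae_restrict_mem measurableSet_Icc
      change ∀ᵐ τ ∂(muT P.T), _
      filter_upwards [heq, hP.a_eq, hP.e_eq, hmem] with τ h1 h2 h3 h4
      simp only [rhs, id, hveq τ h4, hv'eq τ h4]
      rw [h2, h3] at h1
      linarith
    filter_upwards [hae] with τ hτ hmem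
    rw [uIoc_of_le ht.1] at hmem
    exact hτ ⟨hmem.1.le, hmem.2.trans ht.2⟩
  have hvT : v 0 = v P.T := by rw [hv0, hveq P.T hTmem, hper]
  refine ⟨v, v', P.φ (u' 0) + P.F (v 0), hderiv, hv'cont, hvT, fun t ht => ?_, ?_⟩
  · rw [hv'eq t ht, hw t ht, hwt t ht, id]
    ring
  · have h1 := hw P.T hTmem
    rw [hwt P.T hTmem, ← hper', ← hvT] at h1
    linarith

end WEProblem

theorem EReal.exists_real_lt_of_lt_mul {x c : ℝ} (hc : 0 < c) {ω : EReal}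
    (h : (x : EReal) < (c : EReal) * ω) : ∃ m : ℝ, x < c * m ∧ (m : EReal) < ω := by
  induction ω with
  | bot =>
    rw [EReal.coe_mul_bot_of_pos hc] at h
    exact absurd h not_lt_bot
  | coe r =>
    rw [← EReal.coe_mul, EReal.coe_lt_coe_iff, ← div_lt_iff₀' hc] at h
    obtain ⟨m, h1, h2⟩ := exists_between h
    exact ⟨m, (div_lt_iff₀' hc).1 h1, EReal.coe_lt_coe_iff.2 h2⟩
  | top =>
    refine ⟨x / c + 1, ?_, EReal.coe_lt_top _⟩
    rw [mul_add, mul_div_cancel₀ _ hc.ne']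
    linarith

theorem EReal.coe_lt_mul_of_lt {x c m : ℝ} (hc : 0 < c) {ω : EReal} (h : x < c * m)
    (hm : (m : EReal) < ω) : (x : EReal) < (c : EReal) * ω := by
  induction ω with
  | bot => exact absurd hm not_lt_bot
  | coe r =>
    rw [← EReal.coe_mul, EReal.coe_lt_coe_iff]
    exact h.trans (mul_lt_mul_of_pos_left (EReal.coe_lt_coe_iff.1 hm) hc)
  | top =>
    rw [EReal.coe_mul_top_of_pos hc]
    exact EReal.coe_lt_top _

theorem exists_forall_le_of_tendsto_atBot {q : ℝ → ℝ} {ω : EReal}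
    (h : Tendsto (fun u : ℝ => ((q u : ℝ) : EReal)) atBot (nhds ω)) {m : ℝ}
    (hm : (m : EReal) < ω) : ∃ R, 0 ≤ R ∧ ∀ x, x ≤ -R → m ≤ q x := by
  obtain ⟨b, hb⟩ := eventually_atBot.1 (h.eventually (lt_mem_nhds hm))
  refine ⟨|b|, abs_nonneg b, fun x hx => (EReal.coe_lt_coe_iff.1 (hb x ?_)).le⟩
  linarith [neg_abs_le b]

theorem exists_forall_le_of_tendsto_atTop {q : ℝ → ℝ} {ω : EReal}
    (h : Tendsto (fun u : ℝ => ((q u : ℝ) : EReal)) atTop (nhds ω)) {m : ℝ}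
    (hm : (m : EReal) < ω) : ∃ R, 0 ≤ R ∧ ∀ x, R ≤ x → m ≤ q x := by
  obtain ⟨b, hb⟩ := eventually_atTop.1 (h.eventually (lt_mem_nhds hm))
  refine ⟨|b|, abs_nonneg b, fun x hx => (EReal.coe_lt_coe_iff.1 (hb x ?_)).le⟩
  linarith [le_abs_self b]

theorem exists_forall_le_of_tendsto {q : ℝ → ℝ} {ωm ωp : EReal}
    (hbot : Tendsto (fun u : ℝ => ((q u : ℝ) : EReal)) atBot (nhds ωm))
    (htop : Tendsto (fun u : ℝ => ((q u : ℝ) : EReal)) atTop (nhds ωp)) {m : ℝ}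
    (hm : (m : EReal) < min ωm ωp) :
    ∃ R, 0 ≤ R ∧ (∀ x, x ≤ -R → m ≤ q x) ∧ ∀ x, R ≤ x → m ≤ q x := by
  obtain ⟨R₁, h₁, hq₁⟩ := exists_forall_le_of_tendsto_atBot hbot (lt_min_iff.1 hm).1
  obtain ⟨R₂, h₂, hq₂⟩ := exists_forall_le_of_tendsto_atTop htop (lt_min_iff.1 hm).2
  exact ⟨max R₁ R₂, le_max_of_le_left h₁,
    fun x hx => hq₁ x (hx.trans (neg_le_neg (le_max_left _ _))),
    fun x hx => hq₂ x ((le_max_right _ _).trans hx)⟩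

/-- Coefficients that are bounded almost everywhere can be replaced by bounded ones. -/
theorem WEProblem.exists_represents (T : ℝ) (hT : 0 < T) (φ f q a e : ℝ → ℝ)
    (hφmono : StrictMono φ) (hφcont : Continuous φ) (hφsurj : Function.Surjective φ)
    (hφ0 : φ 0 = 0) (hf : Continuous f) (hq : Continuous q)
    (ha_meas : Measurable a) (ha_bdd : ∃ C : ℝ, ∀ᵐ t ∂(muT T), |a t| ≤ C)
    (ha_nonneg : ∀ᵐ t ∂(muT T), 0 ≤ a t) (ha_pos : 0 < ∫ t in Icc (0:ℝ) T, a t)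
    (he_meas : Measurable e) (he_bdd : ∃ C : ℝ, ∀ᵐ t ∂(muT T), |e t| ≤ C)
    (he_mean : ∫ t in Icc (0:ℝ) T, e t = 0) :
    ∃ P : WEProblem, P.T = T ∧ P.φ = φ ∧ P.f = f ∧ P.q = q ∧ P.Represents a e ∧
      P.aI = ∫ t in Icc (0:ℝ) T, a t := by
  obtain ⟨C₁, hC₁⟩ := ha_bdd
  obtain ⟨C₂, hC₂⟩ := he_bdd
  set A := max 0 (max C₁ C₂) with hA
  have hA0 : 0 ≤ A := le_max_left _ _
  have hC₁A : C₁ ≤ A := (le_max_left _ _).trans (le_max_right _ _)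
  have hC₂A : C₂ ≤ A := (le_max_right _ _).trans (le_max_right _ _)
  have hae_a : ∀ᵐ t ∂(muT T), a t = clip 0 A (a t) := by
    filter_upwards [hC₁, ha_nonneg] with t h1 h2
    exact (clip_of_mem ⟨h2, (le_abs_self _).trans (h1.trans hC₁A)⟩).symm
  have hae_e : ∀ᵐ t ∂(muT T), e t = clip (-A) A (e t) := by
    filter_upwards [hC₂] with t h1
    exact (clip_of_mem (abs_le.1 (h1.trans hC₂A))).symm
  have hintegral : ∀ h h₁ : ℝ → ℝ, (∀ᵐ t ∂(muT T), h t = h₁ t) →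
      ∫ t in (0:ℝ)..T, h₁ t = ∫ t in Icc (0:ℝ) T, h t := by
    intro h h₁ hh
    rw [intervalIntegral.integral_of_le hT.le, ← integral_Icc_eq_integral_Ioc]
    exact (integral_congr_ae hh).symm
  exact ⟨{
      T := T, φ := φ, f := f, q := q, a := fun t => clip 0 A (a t),
      e := fun t => clip (-A) A (e t), A := A
      T_pos := hT, φ_mono := hφmono, φ_cont := hφcont, φ_surj := hφsurj, φ_zero := hφ0
      f_cont := hf, q_cont := hq
      a_meas := (continuous_clip _ _).measurable.comp ha_meas
      e_meas := (continuous_clip _ _).measurable.comp he_meas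
      a_nonneg := fun t => (clip_mem hA0 _).1
      a_le := fun t => (clip_mem hA0 _).2
      e_le := fun t => abs_le.2 (clip_mem (by linarith) _)
      a_pos := by rw [hintegral a _ hae_a]; exact ha_pos
      e_mean := by rw [hintegral e _ hae_e]; exact he_mean },
    rfl, rfl, rfl, rfl, ⟨hae_a, hae_e⟩, hintegral a _ hae_a⟩

theorem exists_forall_neg_le {q : ℝ → ℝ} (hq : Continuous q) {m R : ℝ}
    (hql : ∀ x, x ≤ -R → m ≤ q x) (hqr : ∀ x, R ≤ x → m ≤ q x) : ∃ Q, ∀ x, -Q ≤ q x := by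
  obtain ⟨C, hC⟩ := (isCompact_Icc (a := -R) (b := R)).exists_bound_of_continuousOn hq.continuousOn
  refine ⟨max C (-m), fun x => ?_⟩
  have h1 := le_max_left C (-m)
  have h2 := le_max_right C (-m)
  rcases le_total x (-R) with h | h
  · linarith [hql x h]
  · rcases le_total R x with hx | hx
    · linarith [hqr x hx]
    · linarith [(abs_le.1 (hC x ⟨h, hx⟩)).1]

/-- Theorem for type-I nonlinearities with limits `ω₋, ω₊` in the extended reals:
if `q(u) < ω₋` for `u ≤ −D`, `q(u) < ω₊` for `u ≥ D`, and `min{ω₋,ω₊} < +∞`, then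
there is `s₀ < ā·ω₋` realizing the zero/one/two alternative described below. -/
theorem statement15
    (T : ℝ) (hT : 0 < T)
    (φ f q a e : ℝ → ℝ)
    (hφmono : StrictMono φ) (hφcont : Continuous φ)
    (hφsurj : Function.Surjective φ) (hφ0 : φ 0 = 0)
    (hf : Continuous f) (hq : Continuous q)
    (ha_meas : Measurable a) (ha_bdd : ∃ C : ℝ, ∀ᵐ t ∂(muT T), |a t| ≤ C)
    (ha_nonneg : ∀ᵐ t ∂(muT T), 0 ≤ a t)
    (abar : ℝ) (habar_def : (1 / T) * ∫ t in Icc (0:ℝ) T, a t = abar)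
    (habar_pos : 0 < abar)
    (he_meas : Measurable e) (he_bdd : ∃ C : ℝ, ∀ᵐ t ∂(muT T), |e t| ≤ C)
    (he_mean : (1 / T) * ∫ t in Icc (0:ℝ) T, e t = 0)
    (ωm ωp : EReal)
    (hq_bot : Tendsto (fun u : ℝ => ((q u : ℝ) : EReal)) atBot (nhds ωm))
    (hq_top : Tendsto (fun u : ℝ => ((q u : ℝ) : EReal)) atTop (nhds ωp))
    (hD : ∃ D : ℝ, 0 < D ∧ (∀ u : ℝ, u ≤ -D → ((q u : ℝ) : EReal) < ωm) ∧
      ∀ u : ℝ, D ≤ u → ((q u : ℝ) : EReal) < ωp)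
    (hmin : min ωm ωp < ⊤) :
    ∃ s₀ : ℝ, ((s₀ : ℝ) : EReal) < (abar : EReal) * ωm ∧
      (∀ s : ℝ, s < s₀ → ¬∃ u : ℝ → ℝ, IsSolWE T φ f q a e s u) ∧
      (∃ u : ℝ → ℝ, IsSolWE T φ f q a e s₀ u) ∧
      (∀ s : ℝ, s₀ < s → ((s : ℝ) : EReal) < (abar : EReal) * ωm →
        ∃ u : ℝ → ℝ, IsSolWE T φ f q a e s u) ∧
      (∀ s : ℝ, s₀ < s → ((s : ℝ) : EReal) < (abar : EReal) * min ωm ωp →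
        ∃ u₁ u₂ : ℝ → ℝ, IsSolWE T φ f q a e s u₁ ∧ IsSolWE T φ f q a e s u₂ ∧
          ∃ t ∈ Icc (0:ℝ) T, u₁ t ≠ u₂ t) := by
  have hintegral_a : ∫ t in Icc (0:ℝ) T, a t = T * abar := by
    rw [← habar_def]
    field_simp
  have hintegral_e : ∫ t in Icc (0:ℝ) T, e t = 0 := by
    rcases mul_eq_zero.1 he_mean with h | h
    · exact absurd h (by positivity)
    · exact h
  obtain ⟨P, rfl, rfl, rfl, rfl, hP, haI⟩ := WEProblem.exists_represents T hT φ f q a e hφmono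
    hφcont hφsurj hφ0 hf hq ha_meas ha_bdd ha_nonneg (by rw [hintegral_a]; positivity)
    he_meas he_bdd hintegral_e
  rw [hintegral_a] at haI
  have hlt : ∀ s m : ℝ, P.T * s < P.aI * m ↔ s < abar * m := by
    intro s m
    rw [haI, mul_assoc]
    exact mul_lt_mul_iff_right₀ hT
  obtain ⟨D, hD0, hDm, hDp⟩ := hD
  obtain ⟨w, hw⟩ : ∃ w : ℝ, min ωm ωp = w := by
    have hbot : ⊥ < min ωm ωp :=
      lt_min (bot_le.trans_lt (hDm (-D) le_rfl)) (bot_le.trans_lt (hDp D le_rfl))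
    exact ⟨(min ωm ωp).toReal, (EReal.coe_toReal hmin.ne hbot.ne').symm⟩
  obtain ⟨Q, hQ⟩ : ∃ Q, ∀ x, -Q ≤ P.q x := by
    obtain ⟨R, -, hl, hr⟩ := exists_forall_le_of_tendsto hq_bot hq_top (m := w - 1) (by
      rw [hw, EReal.coe_lt_coe_iff]
      linarith)
    exact exists_forall_neg_le hq hl hr
  obtain ⟨s₁, u₁, u₁', k₁, hu₁, hs₁⟩ := P.exists_isInt_lt hQ (w := w) (by
    intro B hB
    rcases min_choice ωm ωp with h | h
    · refine ⟨-D - B, fun x hx => EReal.coe_lt_coe_iff.1 ?_⟩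
      rw [← hw, h]
      exact hDm x (by linarith [hx.2])
    · refine ⟨D + B, fun x hx => EReal.coe_lt_coe_iff.1 ?_⟩
      rw [← hw, h]
      exact hDp x (by linarith [hx.1]))
  rw [hlt, ← EReal.coe_lt_coe_iff, EReal.coe_mul] at hs₁
  obtain ⟨m, hs₁m, hmw⟩ := EReal.exists_real_lt_of_lt_mul habar_pos hs₁
  rw [← hw] at hmw
  obtain ⟨R, hR0, hRl, hRr⟩ := exists_forall_le_of_tendsto hq_bot hq_top hmw
  obtain ⟨s₀, β, β', k₀, hβ, hs₀, hmin₀⟩ := P.exists_minimal_solution hQ hR0 ((hlt _ _).2 hs₁m)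
    hRl hRr ⟨u₁, u₁', k₁, hu₁⟩
  refine ⟨s₀, ?_, ?_, ⟨β, hβ.isSolWE hP⟩, ?_, ?_⟩
  · exact EReal.coe_lt_mul_of_lt habar_pos (hs₀.trans_lt hs₁m) (lt_min_iff.1 hmw).1
  · rintro s hs ⟨u, hu⟩
    obtain ⟨v, v', k, hv⟩ := P.exists_isInt_of_isSolWE hP hu
    exact hs.not_ge (hmin₀ s v v' k hv)
  · intro s hs hsω
    obtain ⟨m, hsm, hm⟩ := EReal.exists_real_lt_of_lt_mul habar_pos hsω
    obtain ⟨R, -, hRl⟩ := exists_forall_le_of_tendsto_atBot hq_bot hm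
    obtain ⟨u, u', k, hu, -⟩ := hβ.exists_solution_below hQ hs ((hlt _ _).2 hsm) hRl
    exact ⟨u, hu.isSolWE hP⟩
  · intro s hs hsω
    obtain ⟨m, hsm, hm⟩ := EReal.exists_real_lt_of_lt_mul habar_pos hsω
    obtain ⟨R, -, hRl, hRr⟩ := exists_forall_le_of_tendsto hq_bot hq_top hm
    obtain ⟨u, u', k, hu, hlow⟩ := hβ.exists_solution_below hQ hs ((hlt _ _).2 hsm) hRl
    obtain ⟨v, v', l, hv, t, ht, hβt⟩ :=
      hβ.exists_solution_not_below hQ hs ((hlt _ _).2 hsm) hRl hRr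
    exact ⟨u, v, hu.isSolWE hP, hv.isSolWE hP, t, ht, ((hlow t ht).trans hβt).ne⟩
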